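/- arXiv:1206.0229 — 3 statements merged into one kernel-verified Lean document; each statement's English description precedes it below -/
import Mathlib

section
/- Let n ≥ 2 and let f : S^n → S^n be a smooth map satisfying f(−p) = R_p f(p) for all p ∈ S^n, such that for every fixed point x of f the map T_x f − I : T_x S^n → T_x S^n is an isomorphism. Then f is not homotopic to a constant map, and if n is odd f is homotopic to the identity map of S^n. -/
open Metric
open scoped RealInnerProductSpace Manifold

noncomputable section

/-- Ambient Euclidean space `ℝ^{n+1}`. -/
abbrev Eu (n : ℕ) : Type := EuclideanSpace ℝ (Fin (n + 1))

/-- The unit sphere `S^n` as a subtype. -/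
abbrev Sph (n : ℕ) := Metric.sphere (0 : Eu n) 1

/-- The reflection `R_p(x) = x - 2(p·x)p` with respect to the hyperplane orthogonal to `p`. -/
def Refl {n : ℕ} (p x : Eu n) : Eu n := x - (2 * ⟪p, x⟫) • p

section DegreeIntegral

open MeasureTheory Set Filter Topology

variable {m : ℕ}

theorem det_one_sub_smul_pos {T : EuclideanSpace ℝ (Fin m) →L[ℝ] EuclideanSpace ℝ (Fin m)}
    {K : ℝ} (hT : ‖T‖ ≤ K) {t : ℝ} (ht0 : 0 ≤ t) (ht : t * K < 1) :
    0 < (ContinuousLinearMap.id ℝ _ - t • T).det := by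
  have hne : ∀ s ∈ Icc (0 : ℝ) t, (ContinuousLinearMap.id ℝ _ - s • T).det ≠ 0 := by
    intro s hs h0
    obtain ⟨v, hv, hv0⟩ := (LinearMap.bot_lt_ker_of_det_eq_zero h0).ne' |>
      (Submodule.ne_bot_iff _).1
    have hv' : v = s • T v := by
      have : v - s • T v = 0 := by simpa using hv
      exact sub_eq_zero.1 this
    have h1 : ‖v‖ ≤ s * (K * ‖v‖) := by
      conv_lhs => rw [hv']
      rw [norm_smul, Real.norm_of_nonneg hs.1]
      gcongr
      · exact hs.1
      · exact T.le_of_opNorm_le hT v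
    have hK : 0 ≤ K := (norm_nonneg T).trans hT
    have h2 : s * K ≤ t * K := by gcongr; exact hs.2
    have h3 : 0 < ‖v‖ := norm_pos_iff.2 hv0
    nlinarith
  have hcont : Continuous fun s : ℝ => (ContinuousLinearMap.id ℝ _ - s • T).det :=
    ContinuousLinearMap.continuous_det.comp (by fun_prop)
  by_contra! hle
  have h1 : (ContinuousLinearMap.id ℝ (EuclideanSpace ℝ (Fin m)) - (0 : ℝ) • T).det = 1 := by
    simp [ContinuousLinearMap.det]
  obtain ⟨s, hs, hs0⟩ := intermediate_value_Icc' ht0 hcont.continuousOn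
    (show (0 : ℝ) ∈ Icc _ _ from ⟨hle, by rw [h1]; exact zero_le_one⟩)
  exact hne s hs hs0

theorem setIntegral_comp_sub_smul_mul_det_of_small
    {Φ : EuclideanSpace ℝ (Fin m) → EuclideanSpace ℝ (Fin m)} (hΦ : ContDiff ℝ 1 Φ)
    {K : NNReal} (hK : LipschitzWith K Φ) {R : ℝ} (hR : ∀ x, x ∉ closedBall 0 R → Φ x = 0)
    {t : ℝ} (ht0 : 0 ≤ t) (ht : t * K < 1) (ρ : EuclideanSpace ℝ (Fin m) → ℝ) :
    ∫ x in closedBall 0 R, ρ (x - t • Φ x) * (ContinuousLinearMap.id ℝ _ - t • fderiv ℝ Φ x).det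
      = ∫ x in closedBall 0 R, ρ x := by
  obtain ⟨τ, rfl⟩ : ∃ τ : NNReal, (τ : ℝ) = t := ⟨⟨t, ht0⟩, rfl⟩
  set G : EuclideanSpace ℝ (Fin m) → EuclideanSpace ℝ (Fin m) := fun x => x - (τ : ℝ) • Φ x with hG
  have happ : ApproximatesLinearOn G
      ((ContinuousLinearEquiv.refl ℝ (EuclideanSpace ℝ (Fin m)) : _ ≃L[ℝ] _) :
        EuclideanSpace ℝ (Fin m) →L[ℝ] EuclideanSpace ℝ (Fin m)) univ (τ * K) := by
    intro x _ y _
    have : G x - G y - (x - y) = - ((τ : ℝ) • (Φ x - Φ y)) := by simp only [hG, smul_sub]; abel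
    simp only [ContinuousLinearEquiv.coe_refl, ContinuousLinearMap.coe_id', id]
    rw [this, norm_neg, norm_smul, Real.norm_of_nonneg ht0]
    simp only [NNReal.coe_mul, mul_assoc]
    gcongr
    exact hK.norm_sub_le x y
  have hc : Subsingleton (EuclideanSpace ℝ (Fin m)) ∨ (τ * K : NNReal) <
      ‖((ContinuousLinearEquiv.refl ℝ (EuclideanSpace ℝ (Fin m))).symm :
        EuclideanSpace ℝ (Fin m) →L[ℝ] EuclideanSpace ℝ (Fin m))‖₊⁻¹ := by
    rcases subsingleton_or_nontrivial (EuclideanSpace ℝ (Fin m)) with h | h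
    · exact Or.inl h
    · right
      simp only [ContinuousLinearEquiv.refl_symm, ContinuousLinearEquiv.coe_refl,
        ContinuousLinearMap.nnnorm_id, inv_one]
      exact_mod_cast ht
  have hinj : Function.Injective G := injOn_univ.1 (happ.injOn hc)
  have hsurj : Function.Surjective G := happ.surjective hc
  have hout : ∀ x, x ∉ closedBall 0 R → G x = x := fun x hx => by simp [hG, hR x hx]
  have himage : G '' closedBall 0 R = closedBall 0 R := by
    ext y
    constructor
    · rintro ⟨x, hx, rfl⟩
      by_contra h
      exact h ((hinj (hout _ h)).symm ▸ hx)
    · intro hy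
      obtain ⟨x, rfl⟩ := hsurj y
      by_cases hx : x ∈ closedBall 0 R
      · exact ⟨x, hx, rfl⟩
      · rw [hout x hx] at hy; exact absurd hy hx
  have hderiv : ∀ x, HasFDerivAt G (ContinuousLinearMap.id ℝ _ - (τ : ℝ) • fderiv ℝ Φ x) x := fun x =>
    (hasFDerivAt_id x).sub
      (((hΦ.differentiable one_ne_zero) x).hasFDerivAt.const_smul (τ : ℝ))
  have hcv := integral_image_eq_integral_abs_det_fderiv_smul volume
    (isClosed_closedBall (x := (0 : EuclideanSpace ℝ (Fin m))) (ε := R)).measurableSet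
    (fun x _ => (hderiv x).hasFDerivWithinAt) hinj.injOn ρ
  rw [himage] at hcv
  rw [hcv]
  refine setIntegral_congr_fun isClosed_closedBall.measurableSet fun x _ => ?_
  have hpos := det_one_sub_smul_pos (norm_fderiv_le_of_lipschitz ℝ hK (x₀ := x)) ht0 ht
  simp only [abs_of_pos hpos, smul_eq_mul]
  rw [mul_comm]

/-- Coordinate functions as continuous maps. -/
def coordMap (i : Fin m) : C(EuclideanSpace ℝ (Fin m), ℝ) := ⟨fun x => x i, by fun_prop⟩

theorem setIntegral_aeval_comp_sub_mul_det
    {Φ : EuclideanSpace ℝ (Fin m) → EuclideanSpace ℝ (Fin m)} (hΦ : ContDiff ℝ 1 Φ)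
    (hc : HasCompactSupport Φ) {R : ℝ} (hR : ∀ x, x ∉ closedBall 0 R → Φ x = 0)
    (p : MvPolynomial (Fin m) ℝ) :
    ∫ x in closedBall 0 R, MvPolynomial.aeval coordMap p (x - Φ x) *
        (ContinuousLinearMap.id ℝ _ - fderiv ℝ Φ x).det
      = ∫ x in closedBall 0 R, MvPolynomial.aeval coordMap p x := by
  obtain ⟨K, hK⟩ := hΦ.lipschitzWith_of_hasCompactSupport hc one_ne_zero
  have hΦ' : Continuous (fderiv ℝ Φ) := hΦ.continuous_fderiv one_ne_zero
  let b := (EuclideanSpace.basisFun (Fin m) ℝ).toBasis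
  let φ : Fin m → C(EuclideanSpace ℝ (Fin m), ℝ) := fun i =>
    ⟨fun x => Φ x i, by have := hΦ.continuous; fun_prop⟩
  let dφ : Fin m → Fin m → C(EuclideanSpace ℝ (Fin m), ℝ) := fun i j =>
    ⟨fun x => fderiv ℝ Φ x (EuclideanSpace.single j 1) i, by fun_prop⟩
  let Q : Polynomial C(EuclideanSpace ℝ (Fin m), ℝ) :=
    MvPolynomial.aeval (fun i => Polynomial.C (coordMap i) - Polynomial.X * Polynomial.C (φ i)) p *
    Matrix.det (Matrix.of fun i j => Polynomial.C (if i = j then 1 else 0) -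
      Polynomial.X * Polynomial.C (dφ i j))
  let ev : EuclideanSpace ℝ (Fin m) → ℝ → Polynomial C(EuclideanSpace ℝ (Fin m), ℝ) →+* ℝ :=
    fun x t => Polynomial.eval₂RingHom
      (ContinuousMap.evalAlgHom ℝ ℝ x : C(EuclideanSpace ℝ (Fin m), ℝ) →+* ℝ) t
  have hevC : ∀ x t c, ev x t (Polynomial.C c) = c x := fun x t c => Polynomial.eval₂_C _ _
  have hevX : ∀ x t, ev x t Polynomial.X = t := fun x t => Polynomial.eval₂_X _ _
  have hev : ∀ x t, ev x t Q = MvPolynomial.aeval coordMap p (x - t • Φ x) *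
      (ContinuousLinearMap.id ℝ _ - t • fderiv ℝ Φ x).det := by
    intro x t
    simp only [Q, map_mul]
    congr 1
    · rw [MvPolynomial.map_aeval]
      have : (MvPolynomial.aeval coordMap p : C(EuclideanSpace ℝ (Fin m), ℝ)) (x - t • Φ x) =
        ((ContinuousMap.evalAlgHom ℝ ℝ (x - t • Φ x) : C(EuclideanSpace ℝ (Fin m), ℝ) →+* ℝ))
          (MvPolynomial.aeval coordMap p) := rfl
      rw [this, MvPolynomial.map_aeval]
      congr 1
      congr 1
      · ext r
        simp [ev, ContinuousMap.evalAlgHom]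
      · funext i
        rw [map_sub, map_mul, hevC, hevC, hevX]
        rfl
    · rw [RingHom.map_det, ContinuousLinearMap.det, ← LinearMap.det_toMatrix b]
      congr 1
      ext i j
      rw [LinearMap.toMatrix_apply]
      by_cases hij : i = j
      · subst hij
        simp [hevC, hevX, b, dφ]
        exact mul_comm _ _
      · simp [hevC, hevX, b, dφ, hij]
        exact mul_comm _ _
  have hc_int : ∀ c : C(EuclideanSpace ℝ (Fin m), ℝ), IntegrableOn c (closedBall 0 R) volume :=
    fun c => c.continuous.continuousOn.integrableOn_compact (isCompact_closedBall _ _)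
  let q : Polynomial ℝ := ∑ k ∈ Finset.range (Q.natDegree + 1),
    Polynomial.C (∫ x in closedBall 0 R, Q.coeff k x) * Polynomial.X ^ k
  have hq : ∀ t, ∫ x in closedBall 0 R, ev x t Q = q.eval t := by
    intro t
    have h1 : ∀ x, ev x t Q = ∑ k ∈ Finset.range (Q.natDegree + 1), Q.coeff k x * t ^ k := by
      intro x
      simp only [ev, Polynomial.coe_eval₂RingHom, Polynomial.eval₂_eq_sum_range]
      rfl
    simp only [h1]
    rw [integral_finsetSum _ fun k _ => (hc_int _).mul_const _]
    simp [q, Polynomial.eval_finsetSum, integral_mul_const]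
  have hqc : q = Polynomial.C (∫ x in closedBall 0 R, MvPolynomial.aeval coordMap p x) := by
    apply Polynomial.eq_of_infinite_eval_eq
    apply Set.Infinite.mono (s := Ioo 0 (1 / ((K : ℝ) + 1)))
    · intro t ht
      simp only [mem_ofPred_eq, Polynomial.eval_C]
      rw [← hq]
      simp only [hev]
      refine setIntegral_comp_sub_smul_mul_det_of_small hΦ hK hR ht.1.le ?_ _
      have hK0 : (0 : ℝ) ≤ K := K.2
      have := ht.2
      rw [lt_div_iff₀ (by positivity)] at this
      nlinarith [ht.1]
    · exact Ioo_infinite (by positivity)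
  have := hq 1
  rw [hqc, Polynomial.eval_C] at this
  rw [← this]
  simp only [hev, one_smul]

theorem separatesPoints_range_aeval_coordMap :
    (MvPolynomial.aeval (R := ℝ) (coordMap (m := m))).range.SeparatesPoints := by
  intro x y hxy
  obtain ⟨i, hi⟩ : ∃ i, x i ≠ y i := by
    by_contra! h
    exact hxy (by ext i; exact h i)
  exact ⟨_, ⟨coordMap i, ⟨MvPolynomial.X i, by simp⟩, rfl⟩, hi⟩

/-- The degree of a compactly supported perturbation of the identity is one. -/
theorem setIntegral_comp_sub_mul_det
    {Φ : EuclideanSpace ℝ (Fin m) → EuclideanSpace ℝ (Fin m)} (hΦ : ContDiff ℝ 1 Φ)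
    (hc : HasCompactSupport Φ) {R : ℝ} (hR : ∀ x, x ∉ closedBall 0 R → Φ x = 0)
    {ρ : EuclideanSpace ℝ (Fin m) → ℝ} (hρ : Continuous ρ) :
    ∫ x in closedBall 0 R, ρ (x - Φ x) * (ContinuousLinearMap.id ℝ _ - fderiv ℝ Φ x).det
      = ∫ x in closedBall 0 R, ρ x := by
  set B : Set (EuclideanSpace ℝ (Fin m)) := closedBall 0 R with hB
  have hBc : IsCompact B := isCompact_closedBall _ _
  set d : EuclideanSpace ℝ (Fin m) → ℝ := fun x =>
    (ContinuousLinearMap.id ℝ _ - fderiv ℝ Φ x).det with hd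
  have hdc : Continuous d := ContinuousLinearMap.continuous_det.comp
    (continuous_const.sub (hΦ.continuous_fderiv one_ne_zero))
  have hGc : Continuous fun x => x - Φ x := continuous_id.sub hΦ.continuous
  have hKc : IsCompact (B ∪ (fun x => x - Φ x) '' B) := hBc.union (hBc.image hGc)
  set C : ℝ := (∫ x in B, |d x|) + ∫ _ in B, (1 : ℝ) with hC
  have hC0 : 0 ≤ C := add_nonneg (integral_nonneg fun _ => abs_nonneg _)
    (integral_nonneg fun _ => zero_le_one)
  have hi : ∀ {f : EuclideanSpace ℝ (Fin m) → ℝ}, Continuous f → IntegrableOn f B volume :=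
    fun hf => hf.continuousOn.integrableOn_compact hBc
  refine eq_of_forall_dist_le fun ε hε => ?_
  obtain ⟨_, ⟨p, rfl⟩, hp⟩ :=
    ContinuousMap.exists_mem_subalgebra_near_continuous_of_isCompact_of_separatesPoints
      separatesPoints_range_aeval_coordMap ⟨ρ, hρ⟩ hKc (ε := ε / (C + 1)) (by positivity)
  set P : C(EuclideanSpace ℝ (Fin m), ℝ) := MvPolynomial.aeval coordMap p with hP
  have hPI := setIntegral_aeval_comp_sub_mul_det hΦ hc hR p
  have hPc : Continuous P := P.continuous
  have e1 : |∫ x in B, (ρ (x - Φ x) * d x - P (x - Φ x) * d x)| ≤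
      ∫ x in B, ε / (C + 1) * |d x| := by
    rw [← Real.norm_eq_abs]
    refine norm_integral_le_of_norm_le (hi (continuous_const.mul hdc.abs)) ?_
    refine (ae_restrict_iff' isClosed_closedBall.measurableSet).2 (ae_of_all _ fun x hx => ?_)
    rw [← sub_mul, norm_mul]
    gcongr
    · rw [norm_sub_rev]; exact (hp _ (Or.inr ⟨x, hx, rfl⟩)).le
    · exact le_rfl
  have e2 : |∫ x in B, (ρ x - P x)| ≤ ∫ x in B, ε / (C + 1) * 1 := by
    rw [← Real.norm_eq_abs]
    refine norm_integral_le_of_norm_le (hi (continuous_const.mul continuous_const)) ?_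
    refine (ae_restrict_iff' isClosed_closedBall.measurableSet).2 (ae_of_all _ fun x hx => ?_)
    rw [norm_sub_rev, mul_one]; exact (hp _ (Or.inl hx)).le
  rw [integral_sub (hi (by fun_prop)) (hi (by fun_prop)), integral_const_mul] at e1
  rw [integral_sub (hi hρ) (hi hPc), integral_const_mul] at e2
  rw [Real.dist_eq]
  have e3 : ε / (C + 1) * (∫ x in B, |d x|) + ε / (C + 1) * (∫ _ in B, (1 : ℝ)) ≤ ε := by
    rw [← mul_add, ← hC, div_mul_eq_mul_div, div_le_iff₀ (by positivity)]
    nlinarith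
  have e4 : (∫ x in B, ρ (x - Φ x) * d x) - ∫ x in B, ρ x =
      ((∫ x in B, ρ (x - Φ x) * d x) - ∫ x in B, P (x - Φ x) * d x) -
      ((∫ x in B, ρ x) - ∫ x in B, P x) := by
    rw [hPI]; ring
  rw [e4]
  exact (abs_sub _ _).trans ((add_le_add e1 e2).trans e3)
theorem _root_.HasStrictFDerivAt.exists_isOpen_injOn_image_mem_nhds
    {G : EuclideanSpace ℝ (Fin m) → EuclideanSpace ℝ (Fin m)}
    {L : EuclideanSpace ℝ (Fin m) →L[ℝ] EuclideanSpace ℝ (Fin m)}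
    {x : EuclideanSpace ℝ (Fin m)} (hG : HasStrictFDerivAt G L x) (hL : L.det ≠ 0)
    {W : Set (EuclideanSpace ℝ (Fin m))} (hW : IsOpen W) (hx : x ∈ W) :
    ∃ U : Set (EuclideanSpace ℝ (Fin m)), IsOpen U ∧ x ∈ U ∧ U ⊆ W ∧ InjOn G U ∧
      G '' U ∈ 𝓝 (G x) := by
  have hst : HasStrictFDerivAt G ((L.toContinuousLinearEquivOfDetNeZero hL : _ ≃L[ℝ] _) :
      _ →L[ℝ] EuclideanSpace ℝ (Fin m)) x := by
    rwa [ContinuousLinearMap.coe_toContinuousLinearEquivOfDetNeZero]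
  have hop := (hst.toOpenPartialHomeomorph G).open_source.inter hW
  have hi : InjOn G (hst.toOpenPartialHomeomorph G).source :=
    (hst.toOpenPartialHomeomorph G).injOn
  have hx' := hst.mem_toOpenPartialHomeomorph_source
  generalize (hst.toOpenPartialHomeomorph G).source = T at hop hi hx'
  refine ⟨T ∩ W, hop, ⟨hx', hx⟩, inter_subset_right, hi.mono inter_subset_left, ?_⟩
  rw [← hst.map_nhds_eq_of_equiv]
  exact image_mem_map (hop.mem_nhds ⟨hx', hx⟩)

/-- If all fixed points of a compactly supported map are nondegenerate, their number is odd. -/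
theorem odd_card_fixedPoints
    {Φ : EuclideanSpace ℝ (Fin m) → EuclideanSpace ℝ (Fin m)} (hΦ : ContDiff ℝ 1 Φ)
    (hc : HasCompactSupport Φ) {S : Finset (EuclideanSpace ℝ (Fin m))}
    (hS : ∀ x, Φ x = x ↔ x ∈ S)
    (hdet : ∀ x ∈ S, (ContinuousLinearMap.id ℝ _ - fderiv ℝ Φ x).det ≠ 0) :
    Odd S.card := by
  classical
  set G : EuclideanSpace ℝ (Fin m) → EuclideanSpace ℝ (Fin m) := fun x => x - Φ x with hG
  set d : EuclideanSpace ℝ (Fin m) → ℝ := fun x =>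
    (ContinuousLinearMap.id ℝ _ - fderiv ℝ Φ x).det with hd
  have hdc : Continuous d := ContinuousLinearMap.continuous_det.comp
    (continuous_const.sub (hΦ.continuous_fderiv one_ne_zero))
  have hGc : Continuous G := continuous_id.sub hΦ.continuous
  have hGd : ContDiff ℝ 1 G := contDiff_id.sub hΦ
  have hGf : ∀ x, HasFDerivAt G (ContinuousLinearMap.id ℝ _ - fderiv ℝ Φ x) x := fun x =>
    (hasFDerivAt_id x).sub ((hΦ.differentiable one_ne_zero) x).hasFDerivAt
  have hG0 : ∀ x, G x = 0 ↔ x ∈ S := fun x => by rw [← hS, hG, sub_eq_zero, eq_comm]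
  -- a ball containing everything
  obtain ⟨R, hR0, hRsub⟩ : ∃ R : ℝ, 0 < R ∧ tsupport Φ ∪ (S : Set _) ⊆ ball 0 R := by
    obtain ⟨R, hR⟩ := (hc.isBounded.union S.finite_toSet.isBounded).subset_ball 0
    exact ⟨max R 1, by positivity, hR.trans (ball_subset_ball (le_max_left _ _))⟩
  have hR : ∀ x, x ∉ closedBall 0 R → Φ x = 0 := fun x hx => by
    by_contra h
    exact hx (ball_subset_closedBall (hRsub (Or.inl (subset_tsupport _ h))))
  -- local inverses
  obtain ⟨V, hV, hVd⟩ := S.finite_toSet.t2_separation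
  have hloc : ∀ x ∈ S, ∃ U : Set (EuclideanSpace ℝ (Fin m)), IsOpen U ∧ x ∈ U ∧ U ⊆ V x ∧
      U ⊆ ball 0 R ∧ InjOn G U ∧ (∀ y ∈ U, 0 < d x * d y) ∧ G '' U ∈ 𝓝 0 := by
    intro x hx
    have hst : HasStrictFDerivAt G (ContinuousLinearMap.id ℝ _ - fderiv ℝ Φ x) x :=
      hGd.contDiffAt.hasStrictFDerivAt' (hGf x) one_ne_zero
    obtain ⟨U, hU, hxU, hUW, hUi, hUn⟩ := hst.exists_isOpen_injOn_image_mem_nhds (hdet x hx)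
      (W := V x ∩ (ball 0 R ∩ {y | 0 < d x * d y}))
      ((hV x).2.inter (isOpen_ball.inter (isOpen_lt continuous_const (continuous_const.mul hdc))))
      ⟨(hV x).1, hRsub (Or.inr hx), mul_self_pos.2 (hdet x hx)⟩
    exact ⟨U, hU, hxU, fun y hy => (hUW hy).1, fun y hy => (hUW hy).2.1, hUi,
      fun y hy => (hUW hy).2.2, (hG0 x).2 hx ▸ hUn⟩
  choose! U hUo hxU hUV hUR hUi hUd hUn using hloc
  have hUdisj : (S : Set (EuclideanSpace ℝ (Fin m))).Pairwise (Function.onFun Disjoint U) :=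
    fun x hx y hy hxy => (hVd hx hy hxy).mono (hUV x hx) (hUV y hy)
  -- a small radius
  have hKc : IsCompact (closedBall 0 R \ ⋃ x ∈ S, U x) :=
    (isCompact_closedBall _ _).diff (isOpen_biUnion fun x hx => hUo x hx)
  have hK0 : (0 : EuclideanSpace ℝ (Fin m)) ∉ G '' (closedBall 0 R \ ⋃ x ∈ S, U x) := by
    rintro ⟨x, ⟨_, hx⟩, hx0⟩
    have hxS := (hG0 x).1 hx0
    exact hx (mem_biUnion hxS (hxU x hxS))
  have hnhds : (ball 0 R ∩ (G '' (closedBall 0 R \ ⋃ x ∈ S, U x))ᶜ) ∩ ⋂ x ∈ S, G '' U x ∈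
      𝓝 (0 : EuclideanSpace ℝ (Fin m)) := by
    refine inter_mem (inter_mem (ball_mem_nhds _ hR0)
      ((hKc.image hGc).isClosed.isOpen_compl.mem_nhds hK0)) ?_
    exact (biInter_finset_mem S).2 hUn
  obtain ⟨ε, hε, hεsub⟩ := Metric.mem_nhds_iff.1 hnhds
  let bump : ContDiffBump (0 : EuclideanSpace ℝ (Fin m)) := ⟨ε / 2, ε, by positivity, by linarith⟩
  set ρ : EuclideanSpace ℝ (Fin m) → ℝ := fun x => bump x with hρ
  have hρc : Continuous ρ := bump.continuous
  have hρ0 : ∀ y, y ∉ ball 0 ε → ρ y = 0 := fun y hy => by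
    have : y ∉ Function.support bump := by rw [bump.support_eq]; exact hy
    exact Function.notMem_support.1 this
  have hρint : ∀ A : Set (EuclideanSpace ℝ (Fin m)), ball 0 ε ⊆ A → 
      ∫ x in A, ρ x = ∫ x, ρ x := fun A hA =>
    setIntegral_eq_integral_of_forall_compl_eq_zero fun x hx => hρ0 x fun h => hx (hA h)
  have hρpos : 0 < ∫ x, ρ x := bump.integral_pos
  have hmain := setIntegral_comp_sub_mul_det hΦ hc hR hρc
  rw [hρint _ fun y hy => ball_subset_closedBall (hεsub hy).1.1] at hmain
  have hUsub : (⋃ x ∈ S, U x) ⊆ closedBall 0 R :=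
    iUnion₂_subset fun x hx => (hUR x hx).trans ball_subset_closedBall
  have hUm : MeasurableSet (⋃ x ∈ S, U x) := 
    (isOpen_biUnion fun x hx => hUo x hx).measurableSet
  have hFc : Continuous fun x => ρ (G x) * d x := (hρc.comp hGc).mul hdc
  change ∫ x in closedBall 0 R, ρ (G x) * d x = _ at hmain
  rw [setIntegral_eq_of_subset_of_forall_sdiff_eq_zero isClosed_closedBall.measurableSet hUsub
    (fun x hx => by
      have : ρ (G x) = 0 := hρ0 _ fun h => (hεsub h).1.2 ⟨x, hx, rfl⟩
      show ρ (G x) * _ = 0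
      rw [this, zero_mul]),
    integral_biUnion_finset S (fun x hx => (hUo x hx).measurableSet) hUdisj
    (fun x hx => (hFc.continuousOn.integrableOn_compact (isCompact_closedBall 0 R)).mono_set
      ((hUR x hx).trans ball_subset_closedBall))] at hmain
  set s : EuclideanSpace ℝ (Fin m) → ℤ := fun x => if 0 < d x then 1 else -1 with hs
  have hterm : ∀ x ∈ S, ∫ y in U x, ρ (G y) * d y = s x * ∫ y, ρ y := by
    intro x hx
    have hcv := integral_image_eq_integral_abs_det_fderiv_smul volume
      (hUo x hx).measurableSet (fun y _ => (hGf y).hasFDerivWithinAt) (hUi x hx) ρ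
    rw [hρint _ fun y hy => mem_iInter₂.1 (hεsub hy).2 x hx] at hcv
    rw [hcv, ← integral_const_mul]
    refine setIntegral_congr_fun (hUo x hx).measurableSet fun y hy => ?_
    have hpos := hUd x hx y hy
    show ρ (G y) * d y = s x * (|d y| • ρ (G y))
    by_cases h : 0 < d x
    · have : 0 < d y := pos_of_mul_pos_right hpos h.le
      simp [hs, h, abs_of_pos this, mul_comm]
    · have : d y < 0 := by
        rcases lt_trichotomy (d y) 0 with h' | h' | h'
        · exact h'
        · simp [h'] at hpos
        · exact absurd (pos_of_mul_pos_left hpos h'.le) h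
      simp [hs, h, abs_of_neg this, mul_comm]
  have hsum : (∑ x ∈ S, (s x : ℝ)) * ∫ y, ρ y = 1 * ∫ y, ρ y := by
    rw [one_mul, Finset.sum_mul]
    exact (Finset.sum_congr rfl fun x hx => (hterm x hx).symm).trans hmain
  have hsum1 : ∑ x ∈ S, s x = 1 := by
    have := mul_right_cancel₀ hρpos.ne' hsum
    exact_mod_cast this
  rw [← ZMod.natCast_eq_one_iff_odd]
  have h2 : ((∑ x ∈ S, s x : ℤ) : ZMod 2) = 1 := by rw [hsum1]; simp
  rw [Int.cast_sum] at h2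
  rw [← h2, Finset.cast_card]
  refine Finset.sum_congr rfl fun x _ => ?_
  by_cases h : 0 < d x
  · simp [hs, h]
  · simp only [hs, h, if_false]; decide

end DegreeIntegral

section RadialExtension

open Filter Topology
open scoped ContDiff

variable {n : ℕ}

/-- The radial projection of `ℝ^{n+1}` to the unit sphere (with a junk value at the origin). -/
def radialProj (x : Eu n) : Sph n :=
  if h : x = 0 then ⟨EuclideanSpace.single 0 1, by simp⟩
  else ⟨‖x‖⁻¹ • x, by simp [norm_smul, h]⟩

theorem coe_radialProj {x : Eu n} (hx : x ≠ 0) : (radialProj x : Eu n) = ‖x‖⁻¹ • x := by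
  simp [radialProj, hx]

theorem norm_coe_sph (x : Sph n) : ‖(x : Eu n)‖ = 1 := by simp

theorem coe_sph_ne_zero (x : Sph n) : (x : Eu n) ≠ 0 := by
  rw [← norm_ne_zero_iff, norm_coe_sph]; exact one_ne_zero

@[simp] theorem radialProj_coe (x : Sph n) : radialProj (x : Eu n) = x := by
  ext1; rw [coe_radialProj (coe_sph_ne_zero x)]; simp

theorem contMDiffAt_radialProj [Fact (Module.finrank ℝ (Eu n) = n + 1)] {x : Eu n} (hx : x ≠ 0) :
    ContMDiffAt 𝓘(ℝ, Eu n) (𝓡 n) ∞ (radialProj (n := n)) x := by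
  let U : TopologicalSpace.Opens (Eu n) := ⟨{0}ᶜ, isOpen_compl_singleton⟩
  have h1 : ContMDiff 𝓘(ℝ, Eu n) 𝓘(ℝ, Eu n) ∞ (fun y : U => (radialProj (y : Eu n) : Eu n)) := by
    have h2 : ∀ y : U, (y : Eu n) ≠ 0 := fun y => y.2
    intro y
    refine ContMDiffAt.congr_of_eventuallyEq
      (f := fun y : U => (fun z : Eu n => ‖z‖⁻¹ • z) y) ?_
      (Eventually.of_forall fun z => coe_radialProj (h2 z))
    rw [contMDiffAt_subtype_iff (f := fun z : Eu n => ‖z‖⁻¹ • z)]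
    refine ContDiffAt.contMDiffAt ?_
    exact ((contDiffAt_norm ℝ (h2 y)).inv (norm_ne_zero_iff.2 (h2 y))).smul contDiffAt_id
  have h3 := h1.codRestrict_sphere (n := n) (fun y => (radialProj (y : Eu n)).2)
  have h4 := h3 ⟨x, hx⟩
  exact (contMDiffAt_subtype_iff (U := U) (x := ⟨x, hx⟩) (f := radialProj (n := n))).1 h4

theorem continuousAt_radialProj {x : Eu n} (hx : x ≠ 0) :
    ContinuousAt (radialProj (n := n)) x := by
  have : Fact (Module.finrank ℝ (Eu n) = n + 1) := ⟨by simp⟩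
  exact (contMDiffAt_radialProj hx).continuousAt

variable [Fact (Module.finrank ℝ (Eu n) = n + 1)] {f : Sph n → Sph n}

theorem contDiffAt_comp_radialProj (hf : ContMDiff (𝓡 n) (𝓡 n) ∞ f) {x : Eu n} (hx : x ≠ 0) :
    ContDiffAt ℝ ∞ (fun y => (f (radialProj y) : Eu n)) x := by
  rw [← contMDiffAt_iff_contDiffAt]
  exact (contMDiff_coe_sphere.comp hf).contMDiffAt.comp x (contMDiffAt_radialProj hx)

theorem eq_zero_of_fderiv_comp_radialProj_eq (hf : ContMDiff (𝓡 n) (𝓡 n) ∞ f) {x : Sph n}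
    (hx : f x = x)
    (hinj : Function.Injective
        (fun v : EuclideanSpace ℝ (Fin n) =>
          (show EuclideanSpace ℝ (Fin n) from
            mfderiv (𝓡 n) (𝓡 n) f x (show TangentSpace (𝓡 n) x from v)) - v))
    {w : Eu n} (hw : fderiv ℝ (fun y => (f (radialProj y) : Eu n)) x w = w) : w = 0 := by
  set ι : EuclideanSpace ℝ (Fin n) →L[ℝ] Eu n :=
    mfderiv (𝓡 n) 𝓘(ℝ, Eu n) ((↑) : Sph n → Eu n) x with hι
  set T : EuclideanSpace ℝ (Fin n) →L[ℝ] EuclideanSpace ℝ (Fin n) :=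
    mfderiv (𝓡 n) (𝓡 n) f x with hT
  set ν : Eu n →L[ℝ] EuclideanSpace ℝ (Fin n) :=
    mfderiv 𝓘(ℝ, Eu n) (𝓡 n) (radialProj (n := n)) (x : Eu n) with hν
  have Hι : ∀ y, y = x → HasMFDerivAt (𝓡 n) 𝓘(ℝ, Eu n) ((↑) : Sph n → Eu n) y ι := by
    rintro _ rfl
    exact ((contMDiff_coe_sphere (m := 1)).mdifferentiable one_ne_zero _).hasMFDerivAt
  have HT : ∀ y, y = x → HasMFDerivAt (𝓡 n) (𝓡 n) f y T := by
    rintro _ rfl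
    exact (hf.mdifferentiable (by simp) _).hasMFDerivAt
  have Hν : HasMFDerivAt 𝓘(ℝ, Eu n) (𝓡 n) (radialProj (n := n)) (x : Eu n) ν :=
    ((contMDiffAt_radialProj (coe_sph_ne_zero x)).mdifferentiableAt (by simp)).hasMFDerivAt
  have hpx : radialProj (x : Eu n) = x := radialProj_coe x
  have hcomp : HasMFDerivAt 𝓘(ℝ, Eu n) 𝓘(ℝ, Eu n) (fun y => (f (radialProj y) : Eu n)) (x : Eu n)
      (ι.comp (T.comp ν)) :=
    (Hι (f (radialProj (x : Eu n))) (by rw [hpx, hx])).comp (x : Eu n)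
      ((HT _ hpx).comp (x : Eu n) Hν)
  have hfd : HasFDerivAt (fun y : Eu n => (f (radialProj y) : Eu n)) (ι.comp (T.comp ν)) (x : Eu n) :=
    hasMFDerivAt_iff_hasFDerivAt.1 hcomp
  rw [hfd.fderiv] at hw
  have hid : HasMFDerivAt (𝓡 n) (𝓡 n) (fun y : Sph n => radialProj (y : Eu n)) x (ν.comp ι) :=
    Hν.comp x (Hι x rfl)
  have hidf : (fun y : Sph n => radialProj (y : Eu n)) = id := funext radialProj_coe
  rw [hidf] at hid
  have hνι : ν.comp ι = ContinuousLinearMap.id ℝ (EuclideanSpace ℝ (Fin n)) :=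
    hasMFDerivAt_unique hid (hasMFDerivAt_id x)
  have hu : ν w = T (ν w) := by
    have := congrArg ν hw
    have h2 := congrArg (fun L : EuclideanSpace ℝ (Fin n) →L[ℝ] EuclideanSpace ℝ (Fin n) =>
      L (T (ν w))) hνι
    exact this.symm.trans h2
  have hν0 : ν w = 0 := by
    apply hinj
    show T (ν w) - ν w = T 0 - 0
    rw [← hu]; simp
  rw [← hw]
  show ι (T (ν w)) = 0
  rw [hν0]; simp

end RadialExtension

section FixedPoints

open Filter Topology Set
open scoped ContDiff

variable {n : ℕ}

/-- The radial extension of a self-map of the sphere, with values in the ambient space. -/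
def radialExt (f : Sph n → Sph n) (y : Eu n) : Eu n := f (radialProj y)

@[simp] theorem radialExt_coe (f : Sph n → Sph n) (x : Sph n) : radialExt f x = f x := by
  simp [radialExt]

theorem norm_radialExt (f : Sph n → Sph n) (y : Eu n) : ‖radialExt f y‖ = 1 := norm_coe_sph _

/-- The fixed points of `f` are nondegenerate, phrased in terms of the radial extension. -/
def NondegenerateFixedPoints (f : Sph n → Sph n) : Prop :=
  ∀ x : Sph n, f x = x → ∀ w : Eu n, fderiv ℝ (radialExt f) x w = w → w = 0

variable {f : Sph n → Sph n}

theorem inner_coe_self (x : Sph n) : ⟪(x : Eu n), (x : Eu n)⟫ = 1 := by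
  rw [real_inner_self_eq_norm_sq, norm_coe_sph, one_pow]

theorem inner_map_neg (hsym : ∀ p : Sph n, (f (-p) : Eu n) = Refl (p : Eu n) (f p : Eu n))
    (p : Sph n) : ⟪((-p : Sph n) : Eu n), (f (-p) : Eu n)⟫ = ⟪(p : Eu n), (f p : Eu n)⟫ := by
  rw [hsym, Refl, coe_neg_sphere, inner_neg_left, inner_sub_right, inner_smul_right,
    inner_coe_self]
  ring

theorem map_eq_self_iff_inner_eq_one (p : Sph n) : f p = p ↔ ⟪(p : Eu n), (f p : Eu n)⟫ = 1 := by
  rw [inner_eq_one_iff_of_norm_eq_one (norm_coe_sph _) (norm_coe_sph _)]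
  exact ⟨fun h => by rw [h], fun h => Subtype.ext h.symm⟩

theorem map_neg_eq_neg_iff
    (hsym : ∀ p : Sph n, (f (-p) : Eu n) = Refl (p : Eu n) (f p : Eu n)) (p : Sph n) :
    f (-p) = -p ↔ f p = p := by
  rw [map_eq_self_iff_inner_eq_one, inner_map_neg hsym, map_eq_self_iff_inner_eq_one]

theorem NondegenerateFixedPoints.det_ne_zero (hD : NondegenerateFixedPoints f) {x : Sph n}
    (hx : f x = x) :
    (ContinuousLinearMap.id ℝ (Eu n) - fderiv ℝ (radialExt f) x).det ≠ 0 := by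
  intro h
  rw [ContinuousLinearMap.det, LinearMap.det_eq_zero_iff_ker_ne_bot] at h
  refine h (LinearMap.ker_eq_bot'.2 fun w hw => hD x hx w ?_)
  have hw' : w - fderiv ℝ (radialExt f) x w = 0 := hw
  exact (sub_eq_zero.1 hw').symm

theorem NondegenerateFixedPoints.finite (hD : NondegenerateFixedPoints f) (hf : Continuous f)
    (hd : ∀ x : Sph n, DifferentiableAt ℝ (radialExt f) x) : {x : Sph n | f x = x}.Finite := by
  by_contra hinf
  obtain ⟨x, hxmem, hacc⟩ := Set.Infinite.exists_accPt_of_subset_isCompact hinf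
    (isClosed_eq hf continuous_id).isCompact Subset.rfl
  have hx : f x = x := hxmem
  have hF : HasFDerivAt (fun y => radialExt f y - y)
      (fderiv ℝ (radialExt f) x - ContinuousLinearMap.id ℝ (Eu n)) (x : Eu n) :=
    (hd x).hasFDerivAt.sub (hasFDerivAt_id _)
  have hne := hF.eventually_ne (c := 0) (by
    obtain ⟨K, -, hK⟩ := (fderiv ℝ (radialExt f) x -
      ContinuousLinearMap.id ℝ (Eu n)).toLinearMap.exists_antilipschitzWith (by
        refine LinearMap.ker_eq_bot'.2 fun w hw => hD x hx w ?_
        simpa [sub_eq_zero] using hw)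
    exact ⟨K, hK⟩)
  have hcoe : Tendsto ((↑) : Sph n → Eu n) (𝓝[≠] x) (𝓝[≠] (x : Eu n)) :=
    tendsto_nhdsWithin_iff.2 ⟨continuous_subtype_val.continuousAt.tendsto.mono_left
      nhdsWithin_le_nhds, eventually_nhdsWithin_of_forall fun y hy h => hy (Subtype.ext h)⟩
  have := (hcoe.eventually hne).and_frequently (accPt_iff_frequently_nhdsNE.1 hacc)
  obtain ⟨y, hy1, hy2⟩ := this.exists
  refine hy1 ?_
  have : f y = y := hy2
  rw [radialExt_coe, this, sub_self]

end FixedPoints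

section NotNullhomotopic

open Filter Topology Set
open scoped ContDiff

variable {n : ℕ} {f : Sph n → Sph n}

/-- A nullhomotopy extends the radial extension of a map of the sphere continuously over the
origin. -/
theorem exists_continuous_eqOn_radialExt {f : C(Sph n, Sph n)} {y : Sph n}
    (H : f.Homotopy (ContinuousMap.const (Sph n) y)) :
    ∃ Ψ : Eu n → Eu n, Continuous Ψ ∧ (∀ x, ‖Ψ x‖ = 1) ∧
      ∀ x, 1 / 2 ≤ ‖x‖ → Ψ x = radialExt f x := by
  refine ⟨fun x => (H (projIcc 0 1 zero_le_one (2 - 4 * ‖x‖), radialProj x) : Eu n), ?_,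
    fun x => norm_coe_sph _, fun x hx => ?_⟩
  · rw [continuous_iff_continuousAt]
    intro x
    by_cases hx : x = 0
    · subst hx
      have : (fun x : Eu n => (y : Eu n)) =ᶠ[𝓝 0]
          fun x => (H (projIcc 0 1 zero_le_one (2 - 4 * ‖x‖), radialProj x) : Eu n) := by
        filter_upwards [ball_mem_nhds (0 : Eu n) (show (0 : ℝ) < 1 / 4 by norm_num)] with x hx
        rw [mem_ball_zero_iff] at hx
        rw [projIcc_of_right_le _ (by linarith)]
        exact congrArg _ (H.apply_one _).symm
      exact continuousAt_const.congr this
    · have h1 : ContinuousAt (fun x : Eu n =>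
          (projIcc (0 : ℝ) 1 zero_le_one (2 - 4 * ‖x‖), radialProj x)) x :=
        (continuous_projIcc.comp (by fun_prop)).continuousAt.prodMk (continuousAt_radialProj hx)
      exact continuous_subtype_val.continuousAt.comp (H.continuous.continuousAt.comp h1)
  · have h2 : 2 - 4 * ‖x‖ ≤ 0 := by linarith
    simp only
    rw [projIcc_of_le_left _ h2]
    exact congrArg _ (H.apply_zero _)

/-- A reflection-symmetric map with nondegenerate fixed points is not nullhomotopic. -/
theorem NondegenerateFixedPoints.not_homotopic_const {f : C(Sph n, Sph n)}
    (hD : NondegenerateFixedPoints f)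
    (hd : ∀ x : Eu n, x ≠ 0 → ContDiffAt ℝ ∞ (radialExt f) x)
    (hsym : ∀ p : Sph n, (f (-p) : Eu n) = Refl (p : Eu n) (f p : Eu n)) (y : Sph n) :
    ¬ f.Homotopic (ContinuousMap.const (Sph n) y) := by
  classical
  rintro ⟨H⟩
  obtain ⟨Ψ, hΨ, hΨ1, hΨf⟩ := exists_continuous_eqOn_radialExt H
  set χ : Eu n → ℝ := fun x => projIcc (0 : ℝ) 1 zero_le_one (3 - ‖x‖) with hχ
  have hχc : Continuous χ :=
    continuous_subtype_val.comp (continuous_projIcc.comp (by fun_prop))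
  have hχ1 : ∀ x, ‖x‖ ≤ 2 → χ x = 1 := fun x hx => by
    rw [hχ]; simp only; rw [projIcc_of_right_le _ (by linarith)]
  have hχ0 : ∀ x, 3 ≤ ‖x‖ → χ x = 0 := fun x hx => by
    rw [hχ]; simp only; rw [projIcc_of_le_left _ (by linarith)]
  have hχI : ∀ x, χ x ∈ Icc (0 : ℝ) 1 := fun x => (projIcc (0 : ℝ) 1 zero_le_one _).2
  have hcut : ∀ x, 1 / 2 ≤ ‖x‖ → ‖x‖ ≤ 2 → χ x • Ψ x = radialExt f x := fun x h h' => by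
    rw [hχ1 x h', one_smul, hΨf x h]
  have hS : IsClosed {x : Eu n | 9 / 10 ≤ ‖x‖ ∧ ‖x‖ ≤ 11 / 10} :=
    (isClosed_le continuous_const continuous_norm).inter
      (isClosed_le continuous_norm continuous_const)
  have hUo : IsOpen {x : Eu n | 1 / 2 < ‖x‖ ∧ ‖x‖ < 2} :=
    (isOpen_lt continuous_const continuous_norm).inter
      (isOpen_lt continuous_norm continuous_const)
  have hU : {x : Eu n | 1 / 2 < ‖x‖ ∧ ‖x‖ < 2} ∈ 𝓝ˢ {x : Eu n | 9 / 10 ≤ ‖x‖ ∧ ‖x‖ ≤ 11 / 10} :=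
    hUo.mem_nhdsSet.2 fun x hx => ⟨by linarith [hx.1], by linarith [hx.2]⟩
  have hUd : ContDiffOn ℝ ((1 : ℕ∞) : WithTop ℕ∞) (fun x => χ x • Ψ x)
      {x : Eu n | 1 / 2 < ‖x‖ ∧ ‖x‖ < 2} := by
    refine ContDiffOn.congr (f := radialExt f) (fun x hx => ?_)
      fun x hx => hcut x hx.1.le hx.2.le
    refine ((hd x ?_).of_le (by exact_mod_cast le_top)).contDiffWithinAt
    rw [← norm_pos_iff]; linarith [hx.1]
  obtain ⟨Φ, hΦ, hΦa, hΦe, hΦs⟩ := (hχc.smul hΨ).exists_contDiff_approx_and_eqOn 1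
    (ε := fun _ => 1 / 10) continuous_const (fun _ => by norm_num) hS hU hUd
  have hΦ' : ContDiff ℝ 1 Φ := by exact_mod_cast hΦ
  have hc : HasCompactSupport Φ := by
    refine HasCompactSupport.of_support_subset_isCompact (isCompact_closedBall 0 3)
      (hΦs.trans fun x hx => ?_)
    rw [mem_closedBall_zero_iff]
    by_contra h
    exact hx (by simp [hχ0 x (not_le.1 h).le])
  have heq : ∀ x : Eu n, 9 / 10 ≤ ‖x‖ → ‖x‖ ≤ 11 / 10 → Φ x = radialExt f x := fun x h h' =>
    (hΦe ⟨h, h'⟩).trans (hcut x (by linarith) (by linarith))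
  have hfixΦ : ∀ x, Φ x = x ↔ ∃ p : Sph n, f p = p ∧ (p : Eu n) = x := by
    intro x
    constructor
    · intro hx
      have ha := hΦa x
      rw [dist_eq_norm, hx] at ha
      change ‖x - χ x • Ψ x‖ < 1 / 10 at ha
      have hn : ‖χ x • Ψ x‖ = χ x := by
        rw [norm_smul, hΨ1, mul_one, Real.norm_of_nonneg (hχI x).1]
      have h1 : ‖x‖ ≤ 11 / 10 := by
        have := norm_le_norm_add_norm_sub' x (χ x • Ψ x)
        linarith [(hχI x).2]
      have h2 : 9 / 10 ≤ ‖x‖ := by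
        rw [norm_sub_rev, hχ1 x (by linarith), one_smul] at ha
        have := norm_le_norm_add_norm_sub' (Ψ x) x
        rw [hΨ1] at this
        linarith
      have h3 := heq x h2 h1
      rw [hx] at h3
      have h4 : x ∈ sphere (0 : Eu n) 1 := by
        rw [mem_sphere_zero_iff_norm, h3, norm_radialExt]
      refine ⟨⟨x, h4⟩, Subtype.ext ?_, rfl⟩
      rw [← radialExt_coe]
      exact h3.symm
    · rintro ⟨p, hp, rfl⟩
      rw [heq _ (by rw [norm_coe_sph]; norm_num) (by rw [norm_coe_sph]; norm_num),
        radialExt_coe, hp]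
  have hfin := hD.finite f.continuous
    (fun x => (hd x (coe_sph_ne_zero x)).differentiableAt (by simp))
  set T : Finset (Sph n) := hfin.toFinset with hT
  have hTmem : ∀ p, p ∈ T ↔ f p = p := fun p => by simp [hT]
  have hodd : Odd (T.map ⟨((↑) : Sph n → Eu n), Subtype.val_injective⟩).card := by
    refine odd_card_fixedPoints hΦ' hc (fun x => ?_) fun x hx => ?_
    · simp [hfixΦ, hTmem]
    · obtain ⟨p, hp, rfl⟩ := Finset.mem_map.1 hx
      have hp' := (hTmem p).1 hp
      have : Φ =ᶠ[𝓝 (p : Eu n)] radialExt f := by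
        have h1 : ∀ᶠ x : Eu n in 𝓝 (p : Eu n), ‖x‖ ∈ Ioo (9 / 10 : ℝ) (11 / 10) := by
          refine continuous_norm.continuousAt.eventually (isOpen_Ioo.mem_nhds ?_)
          simp only [norm_coe_sph]; constructor <;> norm_num
        filter_upwards [h1] with x hx using heq x hx.1.le hx.2.le
      show (ContinuousLinearMap.id ℝ _ - fderiv ℝ Φ (p : Eu n)).det ≠ 0
      rw [this.fderiv_eq]
      exact hD.det_ne_zero hp'
  rw [Finset.card_map, ← ZMod.natCast_eq_one_iff_odd, Finset.cast_card] at hodd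
  have heven : ∑ p ∈ T, (1 : ZMod 2) = 0 := by
    refine Finset.sum_involution (fun p _ => -p) (fun p _ => by decide) (fun p _ _ h => ?_)
      (fun p hp => ?_) fun p _ => neg_neg p
    · exact ne_neg_of_mem_unit_sphere ℝ p h.symm
    · rw [hTmem] at hp ⊢
      exact (map_neg_eq_neg_iff hsym p).2 hp
  rw [heven] at hodd
  exact absurd hodd (by decide)

end NotNullhomotopic

section PolarFields

open Filter Topology Set

variable {n : ℕ} {Y : Type*}

/-- The inverse stereographic projection from the pole `p`, in coordinates for which
`0` is sent to `-p`. -/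
def invStereo (p e : Eu n) : Eu n := (‖e‖ ^ 2 + 1)⁻¹ • ((‖e‖ ^ 2 - 1) • p + (2 : ℝ) • e)

theorem norm_invStereo {p e : Eu n} (hp : ‖p‖ = 1) (h : ⟪p, e⟫ = 0) : ‖invStereo p e‖ = 1 := by
  have h1 : ‖(‖e‖ ^ 2 - 1) • p + (2 : ℝ) • e‖ ^ 2 = (‖e‖ ^ 2 + 1) ^ 2 := by
    rw [norm_add_sq_real, norm_smul, norm_smul, inner_smul_left, inner_smul_right, h, hp,
      mul_pow, mul_pow, Real.norm_eq_abs, sq_abs]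
    norm_num
    ring
  have h2 : (0 : ℝ) < ‖e‖ ^ 2 + 1 := by positivity
  rw [invStereo, norm_smul, (sq_eq_sq₀ (norm_nonneg _) h2.le).1 h1, Real.norm_of_nonneg (by positivity),
    inv_mul_cancel₀ h2.ne']

theorem invStereo_zero (p : Eu n) : invStereo p 0 = -p := by simp [invStereo]

theorem norm_invStereo_sub_le {p : Eu n} (hp : ‖p‖ = 1) (e : Eu n) :
    ‖invStereo p e - p‖ ≤ 4 * (1 + ‖e‖)⁻¹ := by
  have h2 : (0 : ℝ) < ‖e‖ ^ 2 + 1 := by positivity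
  have h1 : invStereo p e - p = (‖e‖ ^ 2 + 1)⁻¹ • ((2 : ℝ) • (e - p)) := by
    rw [eq_inv_smul_iff₀ h2.ne', smul_sub, invStereo, smul_inv_smul₀ h2.ne']
    module
  have h3 : ‖e - p‖ ≤ ‖e‖ + 1 := hp ▸ norm_sub_le e p
  rw [h1, norm_smul, norm_smul, Real.norm_of_nonneg (by positivity), Real.norm_two,
    inv_mul_eq_div, ← div_eq_mul_inv, div_le_div_iff₀ h2 (by positivity)]
  nlinarith [norm_nonneg e, sq_nonneg (‖e‖ - 1)]

theorem continuous_invStereo : Continuous fun q : Eu n × Eu n => invStereo q.1 q.2 := by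
  unfold invStereo
  have h : Continuous fun q : Eu n × Eu n => (‖q.2‖ ^ 2 - 1) • q.1 + (2 : ℝ) • q.2 := by fun_prop
  have h' : Continuous fun q : Eu n × Eu n => ‖q.2‖ ^ 2 + 1 := by fun_prop
  refine (h'.inv₀ fun q => ?_).smul h
  positivity

open Classical in
/-- The map into the sphere defined by a polar field. -/
def polarMap (π : Y → Sph n) (Z : Set Y) (E : Y → Eu n) (y : Y) : Eu n :=
  if y ∈ Z then π y else invStereo (π y) (E y)

theorem polarMap_of_mem {π : Y → Sph n} {Z : Set Y} {E : Y → Eu n} {y : Y} (h : y ∈ Z) :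
    polarMap π Z E y = π y := if_pos h

theorem polarMap_of_notMem {π : Y → Sph n} {Z : Set Y} {E : Y → Eu n} {y : Y} (h : y ∉ Z) :
    polarMap π Z E y = invStereo (π y) (E y) := if_neg h

theorem polarMap_congr {Y' : Type*} {π : Y → Sph n} {Z : Set Y} {E : Y → Eu n} {y : Y}
    {π' : Y' → Sph n} {Z' : Set Y'} {E' : Y' → Eu n} {y' : Y'} (hπ : π y = π' y')
    (hZ : y ∈ Z ↔ y' ∈ Z') (hE : y ∉ Z → E y = E' y') :
    polarMap π Z E y = polarMap π' Z' E' y' := by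
  by_cases h : y ∈ Z
  · rw [polarMap_of_mem h, polarMap, if_pos (hZ.1 h), hπ]
  · rw [polarMap_of_notMem h, polarMap, if_neg (fun h' => h (hZ.2 h')), hπ, hE h]

theorem tendsto_norm_atTop_of_le {E : Y → Eu n} {l : Filter Y} {b : Y → ℝ} {c : ℝ} (hc : 0 < c)
    (hb : Tendsto b l (𝓝 0)) (h : ∀ᶠ y in l, c ≤ ‖E y‖ ^ 2 * b y) :
    Tendsto (fun y => ‖E y‖) l atTop := by
  have hpos : ∀ᶠ y in l, 0 < b y := h.mono fun y hy =>
    pos_of_mul_pos_right (hc.trans_le hy) (sq_nonneg _)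
  have h1 : Tendsto (fun y => (b y)⁻¹) l atTop :=
    tendsto_inv_nhdsGT_zero.comp (tendsto_nhdsWithin_iff.2 ⟨hb, hpos⟩)
  have h2 : Tendsto (fun y => ‖E y‖ ^ 2) l atTop := by
    refine tendsto_atTop_mono' l ?_ (h1.const_mul_atTop hc)
    filter_upwards [h, hpos] with y hy hy'
    rwa [← div_eq_mul_inv, div_le_iff₀ hy']
  refine (Real.tendsto_sqrt_atTop.comp h2).congr fun y => ?_
  exact Real.sqrt_sq (norm_nonneg _)

variable [TopologicalSpace Y]

/-- A tangent field along `π : Y → S^n`, defined and continuous off a closed set `Z` of poles,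
whose norm blows up at the poles. -/
structure PolarField (π : Y → Sph n) (Z : Set Y) (E : Y → Eu n) : Prop where
  isClosed : IsClosed Z
  continuousOn : ContinuousOn E Zᶜ
  inner_eq_zero : ∀ y, y ∉ Z → ⟪(π y : Eu n), E y⟫ = 0
  tendsto : ∀ z ∈ Z, Tendsto (fun y => ‖E y‖) (𝓝[Zᶜ] z) atTop

namespace PolarField

variable {π : Y → Sph n} {Z Z' : Set Y} {E E' : Y → Eu n}

theorem norm_polarMap (h : PolarField π Z E) (y : Y) : ‖polarMap π Z E y‖ = 1 := by
  by_cases hy : y ∈ Z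
  · rw [polarMap_of_mem hy, norm_coe_sph]
  · rw [polarMap_of_notMem hy, norm_invStereo (norm_coe_sph _) (h.inner_eq_zero y hy)]

theorem continuous_polarMap (h : PolarField π Z E) (hπ : Continuous π) :
    Continuous (polarMap π Z E) := by
  have hπ' : Continuous fun y => (π y : Eu n) := continuous_subtype_val.comp hπ
  rw [continuous_iff_continuousAt]
  intro z
  by_cases hz : z ∈ Z
  · have h1 : Tendsto (fun y => polarMap π Z E y - π y) (𝓝 z) (𝓝 0) := by
      rw [← nhdsWithin_univ, ← union_compl_self Z, nhdsWithin_union, tendsto_sup]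
      constructor
      · refine tendsto_const_nhds.congr' ?_
        filter_upwards [self_mem_nhdsWithin] with y hy
        rw [polarMap_of_mem hy, sub_self]
      · have h2 : Tendsto (fun y => 4 * (1 + ‖E y‖)⁻¹) (𝓝[Zᶜ] z) (𝓝 0) := by
          have := (tendsto_inv_atTop_zero.comp
            (tendsto_atTop_add_const_left _ (1 : ℝ) (h.tendsto z hz))).const_mul 4
          rwa [mul_zero] at this
        refine squeeze_zero_norm' ?_ h2
        filter_upwards [self_mem_nhdsWithin] with y hy
        rw [polarMap_of_notMem hy]
        exact norm_invStereo_sub_le (norm_coe_sph _) _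
    have h3 := h1.add hπ'.continuousAt.tendsto
    simp only [sub_add_cancel, zero_add] at h3
    rwa [ContinuousAt, polarMap_of_mem hz]
  · have hE : ContinuousAt E z := h.continuousOn.continuousAt (h.isClosed.isOpen_compl.mem_nhds hz)
    have h1 : ContinuousAt (fun y => invStereo (π y) (E y)) z :=
      continuous_invStereo.continuousAt.comp (f := fun y => ((π y : Eu n), E y))
        (hπ'.continuousAt.prodMk hE)
    refine h1.congr ?_
    filter_upwards [h.isClosed.isOpen_compl.mem_nhds hz] with y hy
    rw [polarMap_of_notMem hy]

/-- The continuous map into the sphere defined by a polar field. -/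
def toMap (h : PolarField π Z E) (hπ : Continuous π) : C(Y, Sph n) :=
  ⟨fun y => ⟨polarMap π Z E y, mem_sphere_zero_iff_norm.2 (h.norm_polarMap y)⟩,
    (h.continuous_polarMap hπ).subtype_mk _⟩

theorem homotopic {Z : Set (unitInterval × Sph n)} {E : unitInterval × Sph n → Eu n}
    (h : PolarField Prod.snd Z E) {g₀ g₁ : C(Sph n, Sph n)}
    (h₀ : ∀ p, (g₀ p : Eu n) = polarMap Prod.snd Z E (0, p))
    (h₁ : ∀ p, (g₁ p : Eu n) = polarMap Prod.snd Z E (1, p)) : g₀.Homotopic g₁ :=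
  ⟨{ toContinuousMap := h.toMap continuous_snd
     map_zero_left := fun p => Subtype.ext (h₀ p).symm
     map_one_left := fun p => Subtype.ext (h₁ p).symm }⟩

theorem comp {X : Type*} [TopologicalSpace X] (h : PolarField π Z E) {φ : X → Y}
    (hφ : Continuous φ) : PolarField (π ∘ φ) (φ ⁻¹' Z) (E ∘ φ) where
  isClosed := h.isClosed.preimage hφ
  continuousOn := h.continuousOn.comp hφ.continuousOn fun _ hx => hx
  inner_eq_zero _ hx := h.inner_eq_zero _ hx
  tendsto _ hz := (h.tendsto _ hz).comp (tendsto_nhdsWithin_iff.2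
    ⟨hφ.continuousAt.tendsto.mono_left nhdsWithin_le_nhds, self_mem_nhdsWithin⟩)

theorem continuousAt (h : PolarField π Z E) {z : Y} (hz : z ∉ Z) : ContinuousAt E z :=
  h.continuousOn.continuousAt (h.isClosed.isOpen_compl.mem_nhds hz)

theorem zero (π : Y → Sph n) : PolarField π ∅ (0 : Y → Eu n) :=
  ⟨isClosed_empty, continuousOn_const, fun _ _ => inner_zero_right _, fun _ h => h.elim⟩

theorem tendsto_add_aux (h : PolarField π Z E) (h' : PolarField π Z' E') (hd : Disjoint Z Z')
    {z : Y} (hz : z ∈ Z) : Tendsto (fun y => ‖(E + E') y‖) (𝓝[(Z ∪ Z')ᶜ] z) atTop := by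
  have h1 : Tendsto (fun y => ‖E y‖) (𝓝[(Z ∪ Z')ᶜ] z) atTop :=
    (h.tendsto z hz).mono_left (nhdsWithin_mono _ (compl_subset_compl.2 subset_union_left))
  have h2 : Tendsto (fun y => -‖E' y‖) (𝓝[(Z ∪ Z')ᶜ] z) (𝓝 (-‖E' z‖)) :=
    ((h'.continuousAt (disjoint_left.1 hd hz)).norm.neg.tendsto).mono_left nhdsWithin_le_nhds
  refine tendsto_atTop_mono (fun y => ?_) (h1.atTop_add h2)
  have := norm_sub_le_norm_add (E y) (E' y)
  simpa [sub_eq_add_neg] using this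

theorem add (h : PolarField π Z E) (h' : PolarField π Z' E') (hd : Disjoint Z Z') :
    PolarField π (Z ∪ Z') (E + E') where
  isClosed := h.isClosed.union h'.isClosed
  continuousOn := (h.continuousOn.mono (compl_subset_compl.2 subset_union_left)).add
    (h'.continuousOn.mono (compl_subset_compl.2 subset_union_right))
  inner_eq_zero y hy := by
    rw [Pi.add_apply, inner_add_right, h.inner_eq_zero y fun hZ => hy (Or.inl hZ),
      h'.inner_eq_zero y fun hZ => hy (Or.inr hZ), add_zero]
  tendsto z hz := by
    rcases hz with hz | hz
    · exact h.tendsto_add_aux h' hd hz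
    · rw [union_comm]
      exact (h'.tendsto_add_aux h hd.symm hz).congr fun y => congrArg _ (add_comm _ _)

end PolarField

end PolarFields

section Charges

open Filter Topology Set

variable {n : ℕ}

/-- The linear map `B` takes values in the orthogonal complement of `x`, and its kernel is the
line spanned by `x`. -/
structure IsCharge (x : Sph n) (B : Eu n →L[ℝ] Eu n) : Prop where
  inner_apply : ∀ p, ⟪(x : Eu n), B p⟫ = 0
  apply_self : B x = 0
  eq_smul : ∀ p, B p = 0 → ∃ c : ℝ, p = c • (x : Eu n)

/-- A tangent field on the sphere with poles at `x` and `-x`, of type prescribed by `B`. -/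
def charge (x : Sph n) (B : Eu n →L[ℝ] Eu n) (p : Eu n) : Eu n :=
  (‖B p‖ ^ 2)⁻¹ • (⟪p, (x : Eu n)⟫ • B p - ⟪p, B p⟫ • (x : Eu n))

theorem charge_neg (x : Sph n) (B : Eu n →L[ℝ] Eu n) (p : Eu n) :
    charge x B (-p) = charge x B p := by
  simp [charge]

theorem inner_charge_eq_zero (x : Sph n) (B : Eu n →L[ℝ] Eu n) (p : Eu n) :
    ⟪p, charge x B p⟫ = 0 := by
  rw [charge, inner_smul_right, inner_sub_right, inner_smul_right, inner_smul_right]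
  ring

namespace IsCharge

variable {x : Sph n} {B : Eu n →L[ℝ] Eu n}

theorem apply_eq_zero_iff (h : IsCharge x B) (p : Sph n) : B p = 0 ↔ p = x ∨ p = -x := by
  constructor
  · intro hp
    obtain ⟨c, hc⟩ := h.eq_smul _ hp
    have h1 : |c| = 1 := by
      have := congrArg norm hc
      rwa [norm_smul, norm_coe_sph, norm_coe_sph, mul_one, eq_comm] at this
    rcases eq_or_eq_neg_of_abs_eq h1 with rfl | rfl
    · left; ext1; rw [hc, one_smul]
    · right; ext1; rw [hc, coe_neg_sphere, neg_one_smul]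
  · rintro (rfl | rfl)
    · exact h.apply_self
    · rw [coe_neg_sphere, map_neg, h.apply_self, neg_zero]

theorem le_norm_charge_sq_mul (h : IsCharge x B) {p : Eu n} (hp : B p ≠ 0) :
    ⟪p, (x : Eu n)⟫ ^ 2 ≤ ‖charge x B p‖ ^ 2 * ‖B p‖ ^ 2 := by
  have h0 : 0 < ‖B p‖ ^ 2 := by positivity
  have h2 : ⟪B p, (x : Eu n)⟫ = 0 := by rw [real_inner_comm, h.inner_apply]
  have h1 : ‖charge x B p‖ ^ 2 * ‖B p‖ ^ 2 =
      ⟪p, (x : Eu n)⟫ ^ 2 + ⟪p, B p⟫ ^ 2 * (‖B p‖ ^ 2)⁻¹ := by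
    rw [charge, norm_smul, mul_pow, norm_sub_sq_real, norm_smul, norm_smul, inner_smul_left,
      inner_smul_right, h2, norm_coe_sph, Real.norm_eq_abs,
      Real.norm_eq_abs, Real.norm_eq_abs, mul_pow, mul_pow, sq_abs, sq_abs, sq_abs]
    field_simp
    ring
  rw [h1]
  exact le_add_of_nonneg_right (by positivity)

theorem polarField {Y : Type*} [TopologicalSpace Y] {π : Y → Sph n} (hπ : Continuous π)
    {B : Y → Eu n →L[ℝ] Eu n} (hB : Continuous B) (h : ∀ y, IsCharge x (B y)) :
    PolarField π {y | π y = x ∨ π y = -x} (fun y => charge x (B y) (π y)) := by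
  have hπ' : Continuous fun y => (π y : Eu n) := continuous_subtype_val.comp hπ
  have hBπ : Continuous fun y => B y (π y) := hB.clm_apply hπ'
  refine ⟨(isClosed_eq hπ continuous_const).union (isClosed_eq hπ continuous_const), ?_,
    fun y _ => inner_charge_eq_zero _ _ _, fun z hz => ?_⟩
  · have h1 : Continuous fun y => ‖B y (π y)‖ ^ 2 := by fun_prop
    have h2 : Continuous fun y => ⟪(π y : Eu n), (x : Eu n)⟫ • B y (π y) -
        ⟪(π y : Eu n), B y (π y)⟫ • (x : Eu n) := by fun_prop
    refine (h1.continuousOn.inv₀ fun y hy => ?_).smul h2.continuousOn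
    have : B y (π y) ≠ 0 := fun h0 => hy (((h y).apply_eq_zero_iff _).1 h0)
    positivity
  · have hz0 : B z (π z) = 0 := ((h z).apply_eq_zero_iff _).2 hz
    have hz1 : ⟪(π z : Eu n), (x : Eu n)⟫ ^ 2 = 1 := by
      rcases hz with hz | hz <;> rw [hz] <;> simp
    have hb : Tendsto (fun y => ‖B y (π y)‖ ^ 2) (𝓝[{y | π y = x ∨ π y = -x}ᶜ] z) (𝓝 0) := by
      have h1 : Continuous fun y => ‖B y (π y)‖ ^ 2 := by fun_prop
      have := h1.tendsto z
      rw [hz0, norm_zero, zero_pow two_ne_zero] at this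
      exact this.mono_left nhdsWithin_le_nhds
    refine tendsto_norm_atTop_of_le (c := 1 / 2) (by norm_num) hb ?_
    have hi : ∀ᶠ y in 𝓝 z, 1 / 2 < ⟪(π y : Eu n), (x : Eu n)⟫ ^ 2 := by
      have hc : Continuous fun y => ⟪(π y : Eu n), (x : Eu n)⟫ ^ 2 := by fun_prop
      exact hc.continuousAt.eventually (lt_mem_nhds (by simp only [hz1]; norm_num))
    filter_upwards [nhdsWithin_le_nhds hi, self_mem_nhdsWithin] with y hy hyZ
    exact hy.le.trans ((h y).le_norm_charge_sq_mul
      fun h0 => hyZ (((h y).apply_eq_zero_iff _).1 h0))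

end IsCharge

/-- The points of `s` and their antipodes. -/
def symmPoles (s : Finset (Sph n)) : Set (Sph n) := {p | p ∈ s ∨ -p ∈ s}

open Classical in
theorem symmPoles_insert (a : Sph n) (s : Finset (Sph n)) :
    symmPoles (insert a s) = symmPoles s ∪ {p | p = a ∨ p = -a} := by
  ext p
  simp only [symmPoles, Finset.mem_insert, Set.mem_ofPred_eq, mem_union, neg_eq_iff_eq_neg]
  tauto

theorem disjoint_symmPoles {a : Sph n} {s : Finset (Sph n)} (ha : a ∉ s) (ha' : -a ∉ s) :
    Disjoint (symmPoles s) {p | p = a ∨ p = -a} := by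
  rw [Set.disjoint_left]
  rintro p (hp | hp) (rfl | rfl)
  · exact ha hp
  · exact ha' hp
  · exact ha' hp
  · exact ha (by rwa [neg_neg] at hp)

theorem polarField_sum_charge (s : Finset (Sph n)) (B : Sph n → Eu n →L[ℝ] Eu n)
    (hs : ∀ x ∈ s, -x ∉ s) (hB : ∀ x ∈ s, IsCharge x (B x)) :
    PolarField id (symmPoles s) (fun p : Sph n => ∑ x ∈ s, charge x (B x) p) := by
  classical
  induction s using Finset.induction_on with
  | empty =>
    have h1 : symmPoles (∅ : Finset (Sph n)) = ∅ := by ext p; simp [symmPoles]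
    rw [h1]
    exact PolarField.zero id
  | insert a s ha ih =>
    have h1 := ih (fun x hx h => hs x (Finset.mem_insert_of_mem hx) (Finset.mem_insert_of_mem h))
      (fun x hx => hB x (Finset.mem_insert_of_mem hx))
    have h2 := IsCharge.polarField (x := a) (π := (id : Sph n → Sph n)) continuous_id
      (B := fun _ => B a) continuous_const fun _ => hB a (Finset.mem_insert_self _ _)
    have ha' : -a ∉ s := fun h => hs a (Finset.mem_insert_self _ _) (Finset.mem_insert_of_mem h)
    have h3 := h1.add h2 (disjoint_symmPoles ha ha')
    have h4 : (fun p : Sph n => ∑ x ∈ insert a s, charge x (B x) p) =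
        (fun p : Sph n => ∑ x ∈ s, charge x (B x) p) + fun p : Sph n => charge a (B a) p := by
      funext p
      rw [Finset.sum_insert ha, add_comm]
      rfl
    rw [symmPoles_insert, h4]
    exact h3

end Charges

section InvertibleMatrices

open Set Matrix

variable {ι : Type*} [Fintype ι] [DecidableEq ι]

/-- Two real matrices are joined by a path of invertible matrices. -/
def GLJoined (A B : Matrix ι ι ℝ) : Prop := JoinedIn {M : Matrix ι ι ℝ | M.det ≠ 0} A B

namespace GLJoined

theorem of_line {A B : Matrix ι ι ℝ} {f : ℝ → Matrix ι ι ℝ} (hf : ContinuousOn f (Icc 0 1))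
    (h₀ : f 0 = A) (h₁ : f 1 = B) (h : ∀ t ∈ Icc (0 : ℝ) 1, (f t).det ≠ 0) : GLJoined A B :=
  JoinedIn.ofLine hf h₀ h₁ (by rintro _ ⟨t, ht, rfl⟩; exact h t ht)

theorem mul {A A' B B' : Matrix ι ι ℝ} (h : GLJoined A A') (h' : GLJoined B B') :
    GLJoined (A * B) (A' * B') := by
  refine (JoinedIn.mul h h').mono ?_
  rintro _ ⟨M, hM, N, hN, rfl⟩
  show (M * N).det ≠ 0
  rw [det_mul]
  exact mul_ne_zero hM hN

theorem transvection (t : TransvectionStruct ι ℝ) : GLJoined 1 t.toMatrix := by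
  refine of_line (f := fun c => Matrix.transvection t.i t.j (c * t.c)) ?_ ?_ ?_ fun c _ => ?_
  · refine Continuous.continuousOn (continuous_const.add ?_)
    exact continuous_matrix fun i j => by
      simp only [Matrix.single_apply]; split_ifs <;> fun_prop
  · simp
  · simp [TransvectionStruct.toMatrix]
  · rw [det_transvection_of_ne _ _ t.hij]; exact one_ne_zero

/-- The matrix of the reflection in the hyperplane orthogonal to `u`. -/
def householder (u : ι → ℝ) : Matrix ι ι ℝ := 1 - (2 / (u ⬝ᵥ u)) • vecMulVec u u

theorem householder_mul_self {u : ι → ℝ} (hu : u ≠ 0) : householder u * householder u = 1 := by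
  have h0 : u ⬝ᵥ u ≠ 0 := fun h => hu (dotProduct_self_eq_zero.1 h)
  have h1 : vecMulVec u u * vecMulVec u u = (u ⬝ᵥ u) • vecMulVec u u := by
    rw [vecMulVec_mul_vecMulVec]; ext i j; simp [vecMulVec_apply]; ring
  rw [householder, sub_mul, mul_sub, mul_sub, one_mul, one_mul, mul_one, smul_mul_smul_comm, h1,
    smul_smul]
  have h2 : 2 / (u ⬝ᵥ u) * (2 / (u ⬝ᵥ u)) * (u ⬝ᵥ u) = 2 / (u ⬝ᵥ u) + 2 / (u ⬝ᵥ u) := by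
    field_simp; norm_num
  rw [h2, add_smul]
  abel

theorem det_householder_ne_zero {u : ι → ℝ} (hu : u ≠ 0) : (householder u).det ≠ 0 := by
  intro h
  have := congrArg det (householder_mul_self hu)
  rw [det_mul, h, zero_mul, det_one] at this
  exact zero_ne_one this

/-- The diagonal matrix with entries `-1` on `s` and `1` off `s`. -/
def signDiag (s : Finset ι) : Matrix ι ι ℝ := diagonal fun j => if j ∈ s then -1 else 1

theorem det_signDiag_ne_zero (s : Finset ι) : (signDiag s).det ≠ 0 := by
  rw [signDiag, det_diagonal, Finset.prod_ne_zero_iff]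
  intro i _
  split_ifs <;> norm_num

theorem signDiag_insert {j : ι} {s : Finset ι} (hj : j ∉ s) :
    signDiag (insert j s) = signDiag {j} * signDiag s := by
  rw [signDiag, signDiag, signDiag, diagonal_mul_diagonal]
  congr 1
  funext k
  by_cases hk : k = j
  · subst hk; simp [hj]
  · simp [hk]

theorem householder_single (j : ι) : householder (Pi.single j 1) = signDiag {j} := by
  ext a b
  rcases eq_or_ne a b with rfl | hab
  · rcases eq_or_ne a j with rfl | haj
    · simp [householder, signDiag, vecMulVec_apply]; norm_num
    · simp [householder, signDiag, vecMulVec_apply, haj]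
  · by_cases haj : a = j
    · subst haj; simp [householder, signDiag, vecMulVec_apply, hab, hab.symm]
    · simp [householder, signDiag, vecMulVec_apply, hab, haj]

theorem refl {A : Matrix ι ι ℝ} (h : A.det ≠ 0) : GLJoined A A := JoinedIn.refl h

theorem signDiag_singleton (i j : ι) : GLJoined (signDiag {i}) (signDiag {j}) := by
  rcases eq_or_ne i j with rfl | hij
  · exact refl (det_signDiag_ne_zero _)
  have hu : ∀ t : ℝ, (1 - t) • Pi.single i (1 : ℝ) + t • (Pi.single j 1 : ι → ℝ) ≠ 0 := by
    intro t h
    have hi := congrFun h i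
    have hj := congrFun h j
    simp [hij] at hi
    simp [hij.symm] at hj
    linarith
  rw [← householder_single, ← householder_single]
  refine of_line (f := fun t => householder ((1 - t) • Pi.single i (1 : ℝ) + t • Pi.single j 1))
    (Continuous.continuousOn ?_) (by simp) (by simp) fun t _ => det_householder_ne_zero (hu t)
  have hc : Continuous fun t : ℝ => (1 - t) • Pi.single i (1 : ℝ) + t • (Pi.single j 1 : ι → ℝ) := by
    fun_prop
  have hd := (hc.dotProduct hc).inv₀ fun t h => hu t (dotProduct_self_eq_zero.1 h)
  exact continuous_const.sub
    ((continuous_const.mul hd).smul (hc.matrix_vecMulVec hc))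

theorem signDiag_parity (i : ι) (s : Finset ι) :
    (Even s.card → GLJoined 1 (signDiag s)) ∧ (Odd s.card → GLJoined (signDiag {i}) (signDiag s)) := by
  induction s using Finset.induction_on with
  | empty =>
    refine ⟨fun _ => ?_, fun h => by simp at h⟩
    have : signDiag (∅ : Finset ι) = 1 := by simp [signDiag]
    rw [this]
    exact refl (by simp)
  | insert j s hj ih =>
    rw [Finset.card_insert_of_notMem hj, signDiag_insert hj]
    have hsq : signDiag {i} * signDiag {i} = 1 := by
      rw [← householder_single, householder_mul_self]
      simp
    constructor
    · intro h
      have := mul (signDiag_singleton i j) (ih.2 (by simpa [parity_simps] using h))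
      rwa [hsq] at this
    · intro h
      have := mul (signDiag_singleton i j) (ih.1 (by simpa [parity_simps] using h))
      rwa [mul_one] at this

theorem diagonal_signDiag {D : ι → ℝ} (hD : (diagonal D).det ≠ 0) :
    GLJoined (signDiag {j | D j < 0}) (diagonal D) := by
  rw [det_diagonal, Finset.prod_ne_zero_iff] at hD
  refine of_line (f := fun t => diagonal fun j => (1 - t) * (if D j < 0 then -1 else 1) + t * D j)
    (Continuous.continuousOn ?_) (by simp [signDiag]) (by simp) fun t ht => ?_
  · exact Continuous.matrix_diagonal (by fun_prop)
  · rw [det_diagonal, Finset.prod_ne_zero_iff]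
    intro j _
    have hj := hD j (Finset.mem_univ _)
    split_ifs with h
    · rcases eq_or_lt_of_le ht.1 with h0 | h0
      · rw [← h0]; norm_num
      · nlinarith [ht.2, mul_neg_of_pos_of_neg h0 h]
    · have h' : 0 < D j := lt_of_le_of_ne (not_lt.1 h) hj.symm
      rcases eq_or_lt_of_le ht.1 with h0 | h0
      · rw [← h0]; norm_num
      · nlinarith [ht.2, mul_pos h0 h']

/-- In odd dimension every invertible real matrix can be joined to `1` or to `-1`. -/
theorem one_or_neg_one (hι : Odd (Fintype.card ι)) {M : Matrix ι ι ℝ} (hM : M.det ≠ 0) :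
    GLJoined 1 M ∨ GLJoined (-1) M := by
  obtain ⟨i⟩ : Nonempty ι := Fintype.card_pos_iff.1 hι.pos
  have huniv : signDiag (Finset.univ : Finset ι) = -1 := by
    ext a b; rcases eq_or_ne a b with rfl | h <;> simp [signDiag, *]
  refine diagonal_transvection_induction_of_det_ne_zero
    (fun M => GLJoined 1 M ∨ GLJoined (-1) M) M hM (fun D hD => ?_)
    (fun t => Or.inl (transvection t)) fun A B _ _ hA hB => ?_
  · have h1 := diagonal_signDiag hD
    rcases Nat.even_or_odd (Finset.card {j | D j < 0}) with h | h
    · exact Or.inl (((signDiag_parity i _).1 h).trans h1)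
    · have h2 := (signDiag_parity i Finset.univ).2 hι
      rw [huniv] at h2
      exact Or.inr ((h2.symm.trans ((signDiag_parity i _).2 h)).trans h1)
  · rcases hA with hA | hA <;> rcases hB with hB | hB
    · left; simpa using mul hA hB
    · right; simpa using mul hA hB
    · right; simpa using mul hA hB
    · left; simpa using mul hA hB

end GLJoined
end InvertibleMatrices

section ChargePaths

open Filter Topology Set

variable {n : ℕ}

/-- The orthogonal projection onto the orthogonal complement of `x`. -/
def tangentProj (x : Sph n) : Eu n →L[ℝ] Eu n :=
  ContinuousLinearMap.id ℝ (Eu n) - (innerSL ℝ (x : Eu n)).smulRight (x : Eu n)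

theorem tangentProj_apply (x : Sph n) (p : Eu n) :
    tangentProj x p = p - ⟪(x : Eu n), p⟫ • (x : Eu n) := rfl

theorem inner_tangentProj (x : Sph n) (p : Eu n) : ⟪(x : Eu n), tangentProj x p⟫ = 0 := by
  rw [tangentProj_apply, inner_sub_right, inner_smul_right, inner_coe_self, mul_one, sub_self]

theorem IsCharge.apply_tangentProj {x : Sph n} {B : Eu n →L[ℝ] Eu n} (h : IsCharge x B)
    (p : Eu n) : B (tangentProj x p) = B p := by
  rw [tangentProj_apply, map_sub, map_smul, h.apply_self, smul_zero, sub_zero]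

/-- In odd dimension, a charge can be deformed to plus or minus the orthogonal projection. -/
theorem IsCharge.exists_path (hn : Odd n) {x : Sph n} {B : Eu n →L[ℝ] Eu n} (h : IsCharge x B) :
    ∃ σ : ℝ, (σ = 1 ∨ σ = -1) ∧ ∃ γ : unitInterval → Eu n →L[ℝ] Eu n, Continuous γ ∧
      γ 0 = B ∧ γ 1 = σ • tangentProj x ∧ ∀ t, IsCharge x (γ t) := by
  have : Fact (Module.finrank ℝ (Eu n) = n + 1) := ⟨by simp⟩
  set V : Submodule ℝ (Eu n) := (ℝ ∙ (x : Eu n))ᗮ with hV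
  have hVmem : ∀ v, v ∈ V ↔ ⟪(x : Eu n), v⟫ = 0 := fun v =>
    Submodule.mem_orthogonal_singleton_iff_inner_right
  let b := (OrthonormalBasis.fromOrthogonalSpanSingleton (𝕜 := ℝ) n (coe_sph_ne_zero x)).toBasis
  let P : Eu n →ₗ[ℝ] V := (tangentProj x).toLinearMap.codRestrict V fun p =>
    (hVmem _).2 (inner_tangentProj x p)
  have hPv : ∀ v : V, P v = v := fun v => Subtype.ext (by
    show tangentProj x (v : Eu n) = v
    rw [tangentProj_apply, (hVmem _).1 v.2, zero_smul, sub_zero])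
  let A : V →ₗ[ℝ] V := (B.toLinearMap.comp V.subtype).codRestrict V fun p =>
    (hVmem _).2 (h.inner_apply _)
  let Φ : Matrix (Fin n) (Fin n) ℝ →ₗ[ℝ] Eu n →L[ℝ] Eu n :=
    { toFun := fun M => LinearMap.toContinuousLinearMap (V.subtype ∘ₗ Matrix.toLin b b M ∘ₗ P)
      map_add' := fun M N => by ext; simp
      map_smul' := fun c M => by ext; simp }
  have hΦ : ∀ M p, Φ M p = (Matrix.toLin b b M (P p) : Eu n) := fun M p => rfl
  have hcharge : ∀ M : Matrix (Fin n) (Fin n) ℝ, M.det ≠ 0 → IsCharge x (Φ M) := by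
    intro M hM
    refine ⟨fun p => ?_, ?_, fun p hp => ?_⟩
    · rw [hΦ]; exact (hVmem _).1 (Subtype.mem _)
    · have : P (x : Eu n) = 0 := Subtype.ext (by
        show tangentProj x (x : Eu n) = 0
        rw [tangentProj_apply, inner_coe_self, one_smul, sub_self])
      rw [hΦ, this, map_zero]; rfl
    · rw [hΦ] at hp
      have h1 : Matrix.toLin b b M (P p) = 0 := Subtype.ext hp
      have h2 : P p = 0 := by
        have hdet : LinearMap.det (Matrix.toLin b b M) ≠ 0 := by rwa [LinearMap.det_toLin]
        exact (LinearMap.ker_eq_bot'.1 (by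
          by_contra hk
          exact hdet (LinearMap.det_eq_zero_iff_ker_ne_bot.2 hk))) _ h1
      have h3 : tangentProj x p = 0 := congrArg Subtype.val h2
      exact ⟨_, sub_eq_zero.1 h3⟩
  have hA : (LinearMap.toMatrix b b A).det ≠ 0 := by
    rw [LinearMap.det_toMatrix]
    intro h0
    rw [LinearMap.det_eq_zero_iff_ker_ne_bot] at h0
    refine h0 (LinearMap.ker_eq_bot'.2 fun v hv => ?_)
    obtain ⟨c, hc⟩ := h.eq_smul v (congrArg Subtype.val hv)
    have h1 := (hVmem _).1 v.2
    rw [hc, inner_smul_right, inner_coe_self, mul_one] at h1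
    exact Subtype.ext (by rw [hc, h1, zero_smul]; rfl)
  have hΦA : Φ (LinearMap.toMatrix b b A) = B := by
    ext1 p
    rw [hΦ, Matrix.toLin_toMatrix]
    exact h.apply_tangentProj p
  have hΦ1 : Φ 1 = tangentProj x := by
    ext1 p
    rw [hΦ, Matrix.toLin_one]
    rfl
  have key : ∀ σ : ℝ, GLJoined (σ • 1) (LinearMap.toMatrix b b A) →
      ∃ γ : unitInterval → Eu n →L[ℝ] Eu n, Continuous γ ∧
      γ 0 = B ∧ γ 1 = σ • tangentProj x ∧ ∀ t, IsCharge x (γ t) := by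
    rintro σ hσ
    obtain ⟨γ, hγ⟩ := JoinedIn.symm hσ
    refine ⟨fun t => Φ (γ t), (LinearMap.continuous_of_finiteDimensional Φ).comp γ.continuous,
      ?_, ?_, fun t => hcharge _ (hγ t)⟩
    · simp only [γ.source, hΦA]
    · simp only [γ.target, map_smul, hΦ1]
  rcases GLJoined.one_or_neg_one (by simpa using hn) hA with h1 | h1
  · exact ⟨1, Or.inl rfl, key 1 (by rwa [one_smul])⟩
  · exact ⟨-1, Or.inr rfl, key (-1) (by rwa [neg_smul, one_smul])⟩

end ChargePaths

section ComplexStructures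

open Filter Topology Set

variable {n : ℕ}

/-- `J` is an orthogonal complex structure. -/
structure IsComplexStructure (J : Eu n →L[ℝ] Eu n) : Prop where
  norm_apply : ∀ p, ‖J p‖ = ‖p‖
  apply_apply : ∀ p, J (J p) = -p

namespace IsComplexStructure

variable {J : Eu n →L[ℝ] Eu n}

theorem inner_apply_apply (h : IsComplexStructure J) (p q : Eu n) : ⟪J p, J q⟫ = ⟪p, q⟫ :=
  LinearIsometry.inner_map_map (⟨J.toLinearMap, h.norm_apply⟩ : Eu n →ₗᵢ[ℝ] Eu n) p q

theorem inner_apply_left (h : IsComplexStructure J) (p q : Eu n) : ⟪J p, q⟫ = -⟪p, J q⟫ := by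
  rw [← h.inner_apply_apply (J p) q, h.apply_apply, inner_neg_left]

theorem inner_apply_self (h : IsComplexStructure J) (p : Eu n) : ⟪p, J p⟫ = 0 := by
  have h1 := h.inner_apply_left p p
  rw [real_inner_comm] at h1
  linarith

theorem exists_of_odd (hn : Odd n) : ∃ J : Eu n →L[ℝ] Eu n, IsComplexStructure J := by
  let sgn : Fin (n + 1) → ℝ := fun i => if i < i.rev then 1 else -1
  have h1 : ∀ i, sgn i ^ 2 = 1 := fun i => by
    by_cases h : i < i.rev <;> simp [sgn, h]
  have h2 : ∀ i, sgn i * sgn i.rev = -1 := fun i => by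
    have h4 : (i : ℕ) ≠ (i.rev : ℕ) := by
      obtain ⟨m, rfl⟩ := hn
      have := i.2
      rw [Fin.val_rev]
      omega
    rcases lt_or_gt_of_ne h4 with h | h
    · have h' : i < i.rev := h
      simp [sgn, h', h'.le]
    · have h' : i.rev < i := h
      simp [sgn, h', h'.le]
  refine ⟨LinearMap.toContinuousLinearMap
    { toFun := fun p => WithLp.toLp 2 fun i => sgn i * p i.rev
      map_add' := fun p q => by ext i; simp [mul_add]
      map_smul' := fun c p => by ext i; simp [mul_left_comm] }, fun p => ?_, fun p => ?_⟩
  · rw [← sq_eq_sq₀ (norm_nonneg _) (norm_nonneg _), EuclideanSpace.norm_sq_eq,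
      EuclideanSpace.norm_sq_eq, ← Equiv.sum_comp Fin.revPerm fun i => ‖p i‖ ^ 2]
    refine Finset.sum_congr rfl fun i _ => ?_
    simp [mul_pow, h1]
  · ext i
    simp [← mul_assoc, h2]

theorem exists_apply_eq (hn : Odd n) {y a : Eu n} (hy : ‖y‖ = 1) (ha : ‖a‖ = 1)
    (hya : ⟪y, a⟫ = 0) : ∃ J : Eu n →L[ℝ] Eu n, IsComplexStructure J ∧ J y = a := by
  obtain ⟨J, hJ⟩ := exists_of_odd hn
  let R := (ℝ ∙ (J y - a))ᗮ.reflection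
  have hR : R (J y) = a := Submodule.reflection_sub (by rw [hJ.norm_apply, hy, ha])
  have hRy : R y = y := by
    refine Submodule.reflection_mem_subspace_eq_self ?_
    rw [Submodule.mem_orthogonal_singleton_iff_inner_right, inner_sub_left, real_inner_comm,
      hJ.inner_apply_self, real_inner_comm, hya, sub_zero]
  refine ⟨(R.toContinuousLinearEquiv : Eu n →L[ℝ] Eu n) ∘L J ∘L
    (R.toContinuousLinearEquiv : Eu n →L[ℝ] Eu n), ⟨fun p => ?_, fun p => ?_⟩, ?_⟩
  · show ‖R (J (R p))‖ = _
    rw [R.norm_map, hJ.norm_apply, R.norm_map]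
  · show R (J (R (R (J (R p))))) = _
    rw [Submodule.reflection_reflection, hJ.apply_apply, map_neg, Submodule.reflection_reflection]
  · show R (J (R y)) = a
    rw [hRy, hR]

end IsComplexStructure

theorem homotopic_neg_id (hn : Odd n) {g : C(Sph n, Sph n)} (hg : ∀ p, g p = -p) :
    g.Homotopic (ContinuousMap.id (Sph n)) := by
  obtain ⟨J, hJ⟩ := IsComplexStructure.exists_of_odd hn
  let F : unitInterval × Sph n → Eu n := fun q =>
    (-Real.cos (Real.pi * (q.1 : ℝ))) • (q.2 : Eu n) + Real.sin (Real.pi * (q.1 : ℝ)) • J q.2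
  have hF : Continuous F := by fun_prop
  have hF1 : ∀ q, ‖F q‖ = 1 := fun q => by
    rw [← sq_eq_sq₀ (norm_nonneg _) zero_le_one, norm_add_sq_real, norm_smul, norm_smul,
      inner_smul_left, inner_smul_right, hJ.inner_apply_self, hJ.norm_apply, norm_coe_sph,
      mul_one, mul_one, Real.norm_eq_abs, Real.norm_eq_abs, sq_abs, sq_abs]
    simp
  exact ⟨{ toFun := fun q => ⟨F q, mem_sphere_zero_iff_norm.2 (hF1 q)⟩
           continuous_toFun := hF.subtype_mk _
           map_zero_left := fun p => Subtype.ext (by simp [F, hg])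
           map_one_left := fun p => Subtype.ext (by simp [F]) }⟩

end ComplexStructures

section RemovingCharges

open Filter Topology Set

variable {n : ℕ}

/-- A unit vector orthogonal to `y` which avoids the planes through `y` and the points of `s`. -/
theorem exists_orthogonal_avoiding (hn : 2 ≤ n) (y : Sph n) (s : Finset (Sph n)) :
    ∃ a : Eu n, ‖a‖ = 1 ∧ ⟪(y : Eu n), a⟫ = 0 ∧
      ∀ z ∈ s, ∀ α c : ℝ, (z : Eu n) = α • (y : Eu n) + c • a → c = 0 := by
  let P : Option s → Subspace ℝ (Eu n) := fun z =>
    Submodule.span ℝ {(y : Eu n), ((z.elim y Subtype.val : Sph n) : Eu n)}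
  have hP : ∀ z, P z ≠ ⊤ := fun z hz => by
    classical
    have h1 := finrank_span_le_card (R := ℝ)
      ({(y : Eu n), ((z.elim y Subtype.val : Sph n) : Eu n)} : Set (Eu n))
    rw [show Submodule.span ℝ _ = (⊤ : Submodule ℝ (Eu n)) from hz, finrank_top,
      finrank_euclideanSpace_fin] at h1
    have h2 : ({(y : Eu n), ((z.elim y Subtype.val : Sph n) : Eu n)} : Set (Eu n)).toFinset.card
        ≤ 2 := by
      rw [Set.toFinset_insert, Set.toFinset_singleton]
      exact Finset.card_le_two
    omega
  obtain ⟨v, hv⟩ : ∃ v, ∀ z, v ∉ P z := by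
    by_contra! h
    obtain ⟨z, hz⟩ := Subspace.exists_eq_top_of_iUnion_eq_univ (p := P)
      (Set.eq_univ_of_forall fun v => Set.mem_iUnion.2 (h v))
    exact hP z hz
  have hyP : ∀ z, (y : Eu n) ∈ P z := fun z => Submodule.subset_span (by simp)
  set w : Eu n := tangentProj y v with hw
  have hvw : v = w + ⟪(y : Eu n), v⟫ • (y : Eu n) := by rw [hw, tangentProj_apply, sub_add_cancel]
  have hw0 : w ≠ 0 := fun h0 => hv none <| by
    rw [hvw, h0, zero_add]
    exact Submodule.smul_mem _ _ (hyP _)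
  refine ⟨‖w‖⁻¹ • w, norm_smul_inv_norm hw0, ?_, fun z hz α c h => ?_⟩
  · rw [inner_smul_right, hw, inner_tangentProj, mul_zero]
  · by_contra hc
    refine hv (some ⟨z, hz⟩) ?_
    have hzP : (z : Eu n) ∈ P (some ⟨z, hz⟩) := Submodule.subset_span (by simp)
    have h1 : w = (c⁻¹ * ‖w‖) • ((z : Eu n) - α • (y : Eu n)) := by
      rw [h, add_sub_cancel_left, smul_smul, smul_smul,
        show c⁻¹ * ‖w‖ * c * ‖w‖⁻¹ = 1 by field_simp, one_smul]
    rw [hvw, h1]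
    exact Submodule.add_mem _
      (Submodule.smul_mem _ _ (Submodule.sub_mem _ hzP (Submodule.smul_mem _ _ (hyP _))))
      (Submodule.smul_mem _ _ (hyP _))

/-- The tangent field `grad ⟨y, ·⟩ + c J` on the sphere. -/
def mergeField (y : Eu n) (J : Eu n →L[ℝ] Eu n) (c : ℝ) (p : Eu n) : Eu n :=
  y - ⟪y, p⟫ • p + c • J p

namespace IsComplexStructure

variable {J : Eu n →L[ℝ] Eu n} {y : Eu n}

theorem inner_mergeField (h : IsComplexStructure J) (c : ℝ) (p : Sph n) :
    ⟪(p : Eu n), mergeField y J c p⟫ = 0 := by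
  rw [mergeField, inner_add_right, inner_sub_right, inner_smul_right, inner_smul_right,
    h.inner_apply_self, inner_coe_self, real_inner_comm]
  ring

theorem eq_of_mergeField_eq_zero (h : IsComplexStructure J) (hy : ‖y‖ = 1) {c : ℝ} {p : Sph n}
    (h0 : mergeField y J c p = 0) :
    ⟪y, (p : Eu n)⟫ ^ 2 + c ^ 2 = 1 ∧ (p : Eu n) = ⟪y, (p : Eu n)⟫ • y + c • J y := by
  set α : ℝ := ⟪y, (p : Eu n)⟫ with hα
  have h1 : y = α • (p : Eu n) - c • J p := by
    rw [mergeField, ← hα] at h0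
    rw [← sub_eq_zero, ← h0]
    abel
  have h2 : α ^ 2 + c ^ 2 = 1 := by
    have h3 : ‖α • (p : Eu n) - c • J p‖ ^ 2 = 1 := by rw [← h1, hy, one_pow]
    rw [norm_sub_sq_real, norm_smul, norm_smul, inner_smul_left, inner_smul_right,
      h.inner_apply_self, h.norm_apply, norm_coe_sph, Real.norm_eq_abs, Real.norm_eq_abs, mul_one,
      mul_one, sq_abs, sq_abs] at h3
    linarith
  refine ⟨h2, ?_⟩
  have h4 : α • y + c • J y = (α ^ 2 + c ^ 2) • (p : Eu n) := by
    conv_lhs => rw [h1]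
    rw [map_sub, map_smul, map_smul, h.apply_apply]
    module
  rw [h4, h2, one_smul]

theorem continuous_mergeField : Continuous fun q : unitInterval × Sph n =>
    mergeField y J (2 * (q.1 : ℝ)) q.2 := by
  unfold mergeField
  fun_prop

theorem polarField (h : IsComplexStructure J) (hy : ‖y‖ = 1) :
    PolarField (Prod.snd : unitInterval × Sph n → Sph n)
      {q | mergeField y J (2 * (q.1 : ℝ)) q.2 = 0}
      (fun q => (1 - (q.1 : ℝ)) • (‖mergeField y J (2 * (q.1 : ℝ)) q.2‖ ^ 2)⁻¹ •
        mergeField y J (2 * (q.1 : ℝ)) q.2) := by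
  have hW := continuous_mergeField (J := J) (y := y)
  have hW2 : Continuous fun q : unitInterval × Sph n =>
    ‖mergeField y J (2 * (q.1 : ℝ)) q.2‖ ^ 2 := hW.norm.pow 2
  refine ⟨isClosed_eq hW continuous_const, ?_, fun q _ => ?_, fun z hz => ?_⟩
  · have h1 : Continuous fun q : unitInterval × Sph n => 1 - (q.1 : ℝ) := by fun_prop
    refine h1.continuousOn.smul ((hW2.continuousOn.inv₀ fun q hq => ?_).smul
      hW.continuousOn)
    have : mergeField y J (2 * (q.1 : ℝ)) q.2 ≠ 0 := hq
    positivity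
  · rw [inner_smul_right, inner_smul_right, h.inner_mergeField, mul_zero, mul_zero]
  · have hz0 : mergeField y J (2 * (z.1 : ℝ)) z.2 = 0 := hz
    have hb : Tendsto (fun q : unitInterval × Sph n => ‖mergeField y J (2 * (q.1 : ℝ)) q.2‖ ^ 2)
        (𝓝[{q | mergeField y J (2 * (q.1 : ℝ)) q.2 = 0}ᶜ] z) (𝓝 0) := by
      have := hW2.tendsto z
      rw [hz0, norm_zero, zero_pow two_ne_zero] at this
      exact this.mono_left nhdsWithin_le_nhds
    refine tendsto_norm_atTop_of_le (c := 1 / 16) (by norm_num) hb ?_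
    have ht : (z.1 : ℝ) ≤ 1 / 2 := by
      have := (h.eq_of_mergeField_eq_zero hy hz0).1
      nlinarith [sq_nonneg ⟪y, (z.2 : Eu n)⟫, z.1.2.1]
    have hc : Continuous fun q : unitInterval × Sph n => (q.1 : ℝ) := by fun_prop
    have hi : ∀ᶠ q in 𝓝 z, ((q : unitInterval × Sph n).1 : ℝ) < 3 / 4 :=
      hc.continuousAt.eventually (gt_mem_nhds (by linarith))
    filter_upwards [nhdsWithin_le_nhds hi, self_mem_nhdsWithin] with q hq hqZ
    have h0 : mergeField y J (2 * (q.1 : ℝ)) q.2 ≠ 0 := hqZ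
    rw [norm_smul, norm_smul, mul_pow, mul_pow, Real.norm_eq_abs, Real.norm_eq_abs, sq_abs, sq_abs]
    have h1 : ‖mergeField y J (2 * (q.1 : ℝ)) q.2‖ ≠ 0 := norm_ne_zero_iff.2 h0
    have h2 : ∀ r : ℝ, r ≠ 0 → (1 - (q.1 : ℝ)) ^ 2 * ((r ^ 2)⁻¹ ^ 2 * r ^ 2) * r ^ 2 =
      (1 - (q.1 : ℝ)) ^ 2 := fun r hr => by field_simp
    rw [h2 _ h1]
    nlinarith

theorem charge_smul_tangentProj {a : Sph n} {σ : ℝ} (hσ : σ = 1 ∨ σ = -1) (p : Sph n) :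
    charge a (σ • tangentProj a) p =
      (‖mergeField (-σ • (a : Eu n)) J 0 p‖ ^ 2)⁻¹ • mergeField (-σ • (a : Eu n)) J 0 p := by
  have hσ2 : σ * σ = 1 := by rcases hσ with rfl | rfl <;> norm_num
  have h1 : mergeField (-σ • (a : Eu n)) J 0 p =
      (-σ) • ((a : Eu n) - ⟪(a : Eu n), (p : Eu n)⟫ • (p : Eu n)) := by
    rw [mergeField, inner_smul_left, zero_smul, add_zero]
    simp only [conj_trivial]
    module
  have hc : ⟪(p : Eu n), (a : Eu n)⟫ = ⟪(a : Eu n), (p : Eu n)⟫ := real_inner_comm _ _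
  have h2 : (⟪(p : Eu n), (a : Eu n)⟫ • (σ • tangentProj a) p -
      ⟪(p : Eu n), (σ • tangentProj a) p⟫ • (a : Eu n)) = mergeField (-σ • (a : Eu n)) J 0 p := by
    rw [h1, smul_apply, tangentProj_apply, inner_smul_right, inner_sub_right,
      inner_smul_right, inner_coe_self, hc]
    module
  have h3 : ‖(σ • tangentProj a) (p : Eu n)‖ ^ 2 = ‖mergeField (-σ • (a : Eu n)) J 0 p‖ ^ 2 := by
    rw [h1, smul_apply, tangentProj_apply, norm_smul, norm_smul, norm_neg,
      mul_pow, mul_pow, norm_sub_sq_real, norm_sub_sq_real, norm_smul, norm_smul,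
      inner_smul_right, inner_smul_right, norm_coe_sph, norm_coe_sph, hc]
  rw [charge, h2, h3]

theorem mergeField_zero_eq_zero_iff (h : IsComplexStructure J) {a : Sph n} {σ : ℝ}
    (hσ : σ = 1 ∨ σ = -1) (p : Sph n) :
    mergeField (-σ • (a : Eu n)) J 0 p = 0 ↔ p = a ∨ p = -a := by
  have hy : ‖-σ • (a : Eu n)‖ = 1 := by
    rw [norm_smul, norm_coe_sph]; rcases hσ with rfl | rfl <;> norm_num
  constructor
  · intro h0
    obtain ⟨h1, h2⟩ := h.eq_of_mergeField_eq_zero hy h0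
    rw [zero_smul, add_zero, smul_smul] at h2
    rw [zero_pow two_ne_zero, add_zero] at h1
    rcases sq_eq_one_iff.1 h1 with h3 | h3 <;> rcases hσ with h4 | h4 <;>
      rw [h3, h4] at h2 <;> simp only [Subtype.ext_iff, coe_neg_sphere] <;> rw [h2] <;> simp
  · rintro (rfl | rfl) <;> simp [mergeField, inner_smul_left]

end IsComplexStructure

/-- A pair of antipodal poles of type `±1` can be merged and removed. -/
theorem PolarField.homotopic_of_add_charge_tangentProj {Z : Set (Sph n)} {E : Sph n → Eu n}
    (hE : PolarField id Z E) {J : Eu n →L[ℝ] Eu n} (hJ : IsComplexStructure J) {a : Sph n}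
    {σ : ℝ} (hσ : σ = 1 ∨ σ = -1) (hd : Disjoint Z {p | p = a ∨ p = -a})
    (hZ : ∀ z ∈ Z, ∀ α c : ℝ,
      (z : Eu n) = α • (-σ • (a : Eu n)) + c • J (-σ • (a : Eu n)) → c = 0)
    {g : C(Sph n, Sph n)}
    (hg : ∀ p, (g p : Eu n) = polarMap id (Z ∪ {p | p = a ∨ p = -a})
      (fun p : Sph n => E p + charge a (σ • tangentProj a) p) p) :
    g.Homotopic (hE.toMap continuous_id) := by
  have hy : ‖-σ • (a : Eu n)‖ = 1 := by
    rw [norm_smul, norm_coe_sph]; rcases hσ with rfl | rfl <;> norm_num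
  have hE' : PolarField (Prod.snd : unitInterval × Sph n → Sph n) (Prod.snd ⁻¹' Z)
    (fun q => E q.2) := hE.comp continuous_snd
  have hdisj : Disjoint (Prod.snd ⁻¹' Z)
      {q : unitInterval × Sph n | mergeField (-σ • (a : Eu n)) J (2 * (q.1 : ℝ)) q.2 = 0} := by
    rw [Set.disjoint_left]
    rintro ⟨t, p⟩ hp hq
    have hq : mergeField (-σ • (a : Eu n)) J (2 * (t : ℝ)) p = 0 := hq
    rw [hZ p hp _ _ (hJ.eq_of_mergeField_eq_zero hy hq).2] at hq
    exact Set.disjoint_left.1 hd hp ((hJ.mergeField_zero_eq_zero_iff hσ p).1 hq)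
  refine (hE'.add (hJ.polarField hy) hdisj).homotopic (fun p => (hg p).trans ?_) fun p => ?_
  · refine polarMap_congr rfl (or_congr Iff.rfl ?_) fun _ => ?_
    · show (p = a ∨ p = -a) ↔ mergeField (-σ • (a : Eu n)) J (2 * ((0 : unitInterval) : ℝ)) p = 0
      rw [Set.Icc.coe_zero, mul_zero, hJ.mergeField_zero_eq_zero_iff hσ]
    · simp only [Pi.add_apply, Set.Icc.coe_zero, mul_zero, sub_zero, one_smul,
        IsComplexStructure.charge_smul_tangentProj (J := J) hσ]
  · refine polarMap_congr rfl (Iff.symm (or_iff_left fun h => ?_)) fun _ => ?_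
    · have := (hJ.eq_of_mergeField_eq_zero hy h).1
      simp only [Set.Icc.coe_one] at this
      nlinarith [sq_nonneg ⟪-σ • (a : Eu n), (p : Eu n)⟫]
    · simp only [Pi.add_apply, Set.Icc.coe_one, sub_self, zero_smul, add_zero]

/-- A pair of antipodal poles can be removed. -/
theorem PolarField.homotopic_of_add_charge (hn : Odd n) (hn2 : 2 ≤ n) {s : Finset (Sph n)}
    {E : Sph n → Eu n} (hE : PolarField id (symmPoles s) E) {a : Sph n} (ha : a ∉ s)
    (ha' : -a ∉ s) {B : Eu n →L[ℝ] Eu n} (hB : IsCharge a B) {g : C(Sph n, Sph n)}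
    (hg : ∀ p, (g p : Eu n) = polarMap id (symmPoles s ∪ {p | p = a ∨ p = -a})
      (fun p : Sph n => E p + charge a B p) p) :
    g.Homotopic (hE.toMap continuous_id) := by
  obtain ⟨σ, hσ, γ, hγ, hγ0, hγ1, hγB⟩ := hB.exists_path hn
  have hd := disjoint_symmPoles ha ha'
  have h1 : PolarField (Prod.snd : unitInterval × Sph n → Sph n) (Prod.snd ⁻¹' symmPoles s)
    (fun q => E q.2) := hE.comp continuous_snd
  have h2 := h1.add (IsCharge.polarField continuous_snd (hγ.comp continuous_fst)
    fun q => hγB q.1) (hd.preimage _)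
  let g₁ : C(Sph n, Sph n) :=
    (h2.comp (φ := fun p : Sph n => ((1 : unitInterval), p)) (by fun_prop)).toMap continuous_id
  have hg₁ : g.Homotopic g₁ := by
    refine h2.homotopic (fun p => (hg p).trans ?_) fun p => rfl
    refine polarMap_congr rfl Iff.rfl fun _ => ?_
    simp only [Pi.add_apply, Function.comp_apply, hγ0]
  refine hg₁.trans ?_
  let y : Sph n := ⟨-σ • (a : Eu n), mem_sphere_zero_iff_norm.2 (by
    rw [norm_smul, norm_coe_sph]; rcases hσ with rfl | rfl <;> norm_num)⟩
  obtain ⟨b, hb, hyb, hbs⟩ := exists_orthogonal_avoiding hn2 y s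
  obtain ⟨J, hJ, rfl⟩ := IsComplexStructure.exists_apply_eq hn (norm_coe_sph y) hb hyb
  refine hE.homotopic_of_add_charge_tangentProj hJ hσ hd (fun z hz α c h => ?_) fun p => ?_
  · rcases hz with hz | hz
    · exact hbs _ hz _ _ h
    · refine neg_eq_zero.1 (hbs _ hz (-α) _ ?_)
      rw [coe_neg_sphere, h, neg_smul _ (y : Eu n), neg_smul _ (J y), neg_add]
  · refine polarMap_congr rfl Iff.rfl fun _ => ?_
    simp only [Pi.add_apply, Function.comp_apply, hγ1]

theorem homotopic_neg_of_sum_charge (hn : Odd n) (hn2 : 2 ≤ n) (B : Sph n → Eu n →L[ℝ] Eu n)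
    {g₁ : C(Sph n, Sph n)} (hg₁ : ∀ p, g₁ p = -p) (s : Finset (Sph n)) :
    (∀ x ∈ s, -x ∉ s) → (∀ x ∈ s, IsCharge x (B x)) → ∀ g : C(Sph n, Sph n),
      (∀ p, (g p : Eu n) = polarMap id (symmPoles s)
        (fun p : Sph n => ∑ x ∈ s, charge x (B x) p) p) → g.Homotopic g₁ := by
  classical
  induction s using Finset.induction_on with
  | empty =>
    intro _ _ g hg
    have : g = g₁ := by
      ext1 p
      ext1
      rw [hg, hg₁, polarMap_of_notMem (by simp [symmPoles])]
      simp [invStereo_zero]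
    rw [this]
  | insert a s ha ih =>
    intro hs hB g hg
    have hs' : ∀ x ∈ s, -x ∉ s := fun x hx h =>
      hs x (Finset.mem_insert_of_mem hx) (Finset.mem_insert_of_mem h)
    have hB' : ∀ x ∈ s, IsCharge x (B x) := fun x hx => hB x (Finset.mem_insert_of_mem hx)
    have ha' : -a ∉ s := fun h => hs a (Finset.mem_insert_self _ _) (Finset.mem_insert_of_mem h)
    refine ((polarField_sum_charge s B hs' hB').homotopic_of_add_charge hn hn2 ha ha'
      (hB a (Finset.mem_insert_self _ _)) fun p => ?_).trans (ih hs' hB' _ fun p => rfl)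
    rw [hg]
    refine polarMap_congr rfl ?_ fun _ => ?_
    · rw [symmPoles_insert]
    · rw [Finset.sum_insert ha, add_comm]

end RemovingCharges

section Displacement

open Filter Topology Set Asymptotics
open scoped ContDiff

variable {n : ℕ}

/-- Two polar fields with the same poles which do not point in opposite directions near the poles
can be interpolated linearly. -/
theorem PolarField.interpolate {Z : Set (Sph n)} {E₀ E₁ : Sph n → Eu n}
    (h₀ : PolarField id Z E₀) (h₁ : PolarField id Z E₁)
    (hC : ∀ z ∈ Z, ∃ C : ℝ, ∀ᶠ p in 𝓝[Zᶜ] z, -(C * ‖E₀ p‖) ≤ ⟪E₀ p, E₁ p⟫) :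
    PolarField (Prod.snd : unitInterval × Sph n → Sph n) (Prod.snd ⁻¹' Z)
      (fun q => (1 - (q.1 : ℝ)) • E₀ q.2 + (q.1 : ℝ) • E₁ q.2) := by
  have hs : MapsTo (Prod.snd : unitInterval × Sph n → Sph n) (Prod.snd ⁻¹' Z)ᶜ Zᶜ := fun _ h => h
  have hsnd : Continuous (Prod.snd : unitInterval × Sph n → Sph n) := continuous_snd
  refine ⟨h₀.isClosed.preimage hsnd, ?_, fun q hq => ?_, fun z hz => ?_⟩
  · have h1 : Continuous fun q : unitInterval × Sph n => 1 - (q.1 : ℝ) := by fun_prop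
    have h2 : Continuous fun q : unitInterval × Sph n => (q.1 : ℝ) := by fun_prop
    exact (h1.continuousOn.smul (h₀.continuousOn.comp hsnd.continuousOn hs)).add
      (h2.continuousOn.smul (h₁.continuousOn.comp hsnd.continuousOn hs))
  · have h1 : ⟪(q.2 : Eu n), E₀ q.2⟫ = 0 := h₀.inner_eq_zero _ hq
    have h2 : ⟪(q.2 : Eu n), E₁ q.2⟫ = 0 := h₁.inner_eq_zero _ hq
    rw [inner_add_right, inner_smul_right, inner_smul_right, h1, h2, mul_zero, mul_zero, add_zero]
  · have hz' : z.2 ∈ Z := hz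
    obtain ⟨C, hC⟩ := hC z.2 hz'
    have hl : Tendsto (Prod.snd : unitInterval × Sph n → Sph n) (𝓝[(Prod.snd ⁻¹' Z)ᶜ] z)
        (𝓝[Zᶜ] z.2) := hsnd.continuousAt.continuousWithinAt.tendsto_nhdsWithin hs
    rw [Filter.tendsto_atTop]
    intro R
    filter_upwards [hl.eventually hC,
      hl.eventually ((h₀.tendsto _ hz').eventually_ge_atTop (2 * |R| + 4 * |C|)),
      hl.eventually ((h₁.tendsto _ hz').eventually_ge_atTop (2 * |R| + 4 * |C|))] with q hq hq0 hq1
    obtain ⟨t, p⟩ := q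
    obtain ⟨t, ht0, ht1⟩ := t
    simp only at hq hq0 hq1 ⊢
    refine (le_abs_self R).trans ((sq_le_sq₀ (abs_nonneg R) (norm_nonneg _)).1 ?_)
    rw [norm_add_sq_real, norm_smul, norm_smul, inner_smul_left, inner_smul_right,
      Real.norm_of_nonneg ht0, Real.norm_of_nonneg (sub_nonneg.2 ht1)]
    simp only [conj_trivial]
    set a := ‖E₀ p‖
    set b := ‖E₁ p‖
    have ht1' : 0 ≤ 1 - t := sub_nonneg.2 ht1
    have ha : 0 ≤ a := norm_nonneg _
    have hb : 0 ≤ b := norm_nonneg _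
    have hCa := le_abs_self C
    have hC0 := abs_nonneg C
    have hR0 := abs_nonneg R
    set K := |C|
    set T := |R|
    have h1 : (1 - t) * (t * (-(K * a))) ≤ (1 - t) * (t * ⟪E₀ p, E₁ p⟫) := by
      refine mul_le_mul_of_nonneg_left (mul_le_mul_of_nonneg_left (le_trans ?_ hq) ht0) ht1'
      exact neg_le_neg (mul_le_mul_of_nonneg_right hCa ha)
    have h2 : (1 - t) * (t * (K * a)) ≤ K * ((1 - t) * a) := by
      have : 0 ≤ (1 - t) * (K * a) := by positivity
      nlinarith
    have h3 : 2 * T + 4 * K ≤ (1 - t) * a + t * b := by nlinarith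
    have hu : 0 ≤ (1 - t) * a := by positivity
    have hw : 0 ≤ t * b := by positivity
    generalize (1 - t) * a = u at *
    generalize t * b = w at *
    have h4 : (u + w) * T ≤ (u + w) * ((u + w) / 2 - 2 * K) :=
      mul_le_mul_of_nonneg_left (by linarith) (by linarith)
    have h5 : T * T ≤ (u + w) * T := mul_le_mul_of_nonneg_right (by linarith) hR0
    have h6 : 0 ≤ K * w := by positivity
    nlinarith [sq_nonneg (u - w)]

theorem PolarField.homotopic_of_inner_ge {Z : Set (Sph n)} {E₀ E₁ : Sph n → Eu n}
    (h₀ : PolarField id Z E₀) (h₁ : PolarField id Z E₁)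
    (hC : ∀ z ∈ Z, ∃ C : ℝ, ∀ᶠ p in 𝓝[Zᶜ] z, -(C * ‖E₀ p‖) ≤ ⟪E₀ p, E₁ p⟫)
    {g : C(Sph n, Sph n)} (hg : ∀ p, (g p : Eu n) = polarMap id Z E₀ p) :
    g.Homotopic (h₁.toMap continuous_id) := by
  refine (h₀.interpolate h₁ hC).homotopic (fun p => (hg p).trans ?_) fun p => ?_
  · refine polarMap_congr rfl Iff.rfl fun _ => ?_
    simp only [Set.Icc.coe_zero, sub_zero, one_smul, zero_smul, add_zero]
  · refine polarMap_congr rfl Iff.rfl fun _ => ?_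
    simp only [Set.Icc.coe_one, sub_self, one_smul, zero_smul, zero_add]

/-- The polar field corresponding to a self-map of the sphere. -/
def dispField (f : Sph n → Sph n) (p : Sph n) : Eu n :=
  (1 - ⟪(p : Eu n), (f p : Eu n)⟫)⁻¹ • ((f p : Eu n) - ⟪(p : Eu n), (f p : Eu n)⟫ • (p : Eu n))

variable {f : Sph n → Sph n}

theorem norm_dispField_sq_mul {p : Sph n} (hp : f p ≠ p) :
    ‖dispField f p‖ ^ 2 * (1 - ⟪(p : Eu n), (f p : Eu n)⟫) = 1 + ⟪(p : Eu n), (f p : Eu n)⟫ := by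
  have h1 : 1 - ⟪(p : Eu n), (f p : Eu n)⟫ ≠ 0 := fun h =>
    hp ((map_eq_self_iff_inner_eq_one p).2 (sub_eq_zero.1 h).symm)
  rw [dispField, norm_smul, mul_pow, norm_sub_sq_real, norm_smul, inner_smul_right,
    real_inner_comm (p : Eu n) (f p : Eu n), norm_coe_sph, norm_coe_sph, norm_inv, Real.norm_eq_abs, Real.norm_eq_abs,
    inv_pow, sq_abs, mul_one, sq_abs]
  field_simp
  ring

theorem coe_eq_polarMap_dispField (p : Sph n) :
    (f p : Eu n) = polarMap id {x | f x = x} (dispField f) p := by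
  by_cases hp : f p = p
  · rw [polarMap_of_mem (show p ∈ {x | f x = x} from hp), id, hp]
  · rw [polarMap_of_notMem (show p ∉ {x | f x = x} from hp)]
    have h1 : 1 - ⟪(p : Eu n), (f p : Eu n)⟫ ≠ 0 := fun h =>
      hp ((map_eq_self_iff_inner_eq_one p).2 (sub_eq_zero.1 h).symm)
    have h2 := norm_dispField_sq_mul hp
    set h := ⟪(p : Eu n), (f p : Eu n)⟫ with hh
    have h3 : ‖dispField f p‖ ^ 2 = (1 + h) * (1 - h)⁻¹ := by rw [← h2]; field_simp
    rw [invStereo, h3, dispField, ← hh,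
      show (1 + h) * (1 - h)⁻¹ + 1 = 2 * (1 - h)⁻¹ by field_simp; ring,
      show (1 + h) * (1 - h)⁻¹ - 1 = 2 * (1 - h)⁻¹ * h by field_simp; ring,
      eq_inv_smul_iff₀ (by positivity), id]
    module

theorem polarField_dispField (hf : Continuous f) :
    PolarField id {x | f x = x} (dispField f) := by
  have hcf : Continuous fun p : Sph n => (f p : Eu n) := continuous_subtype_val.comp hf
  have hh : Continuous fun p : Sph n => ⟪(p : Eu n), (f p : Eu n)⟫ := by fun_prop
  have hne : ∀ p : Sph n, f p ≠ p → 1 - ⟪(p : Eu n), (f p : Eu n)⟫ ≠ 0 := fun p hp h =>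
    hp ((map_eq_self_iff_inner_eq_one p).2 (sub_eq_zero.1 h).symm)
  refine ⟨isClosed_eq hf continuous_id, ?_, fun p _ => ?_, fun z hz => ?_⟩
  · have h1 : Continuous fun p : Sph n => 1 - ⟪(p : Eu n), (f p : Eu n)⟫ := by fun_prop
    have h2 : Continuous fun p : Sph n =>
      (f p : Eu n) - ⟪(p : Eu n), (f p : Eu n)⟫ • (p : Eu n) := by fun_prop
    exact (h1.continuousOn.inv₀ hne).smul h2.continuousOn
  · rw [id, dispField, inner_smul_right, inner_sub_right, inner_smul_right, inner_coe_self]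
    ring
  · have hz1 : ⟪(z : Eu n), (f z : Eu n)⟫ = 1 := (map_eq_self_iff_inner_eq_one z).1 hz
    have h1 : Tendsto (fun p : Sph n => 1 - ⟪(p : Eu n), (f p : Eu n)⟫) (𝓝 z) (𝓝 0) := by
      have := (hh.tendsto z).const_sub 1
      rwa [hz1, sub_self] at this
    refine tendsto_norm_atTop_of_le one_pos (h1.mono_left nhdsWithin_le_nhds) ?_
    have h2 : ∀ᶠ p : Sph n in 𝓝 z, 0 < ⟪(p : Eu n), (f p : Eu n)⟫ :=
      hh.continuousAt.eventually (lt_mem_nhds (by simp only [hz1]; exact one_pos))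
    filter_upwards [nhdsWithin_le_nhds h2, self_mem_nhdsWithin] with p hp hpZ
    rw [norm_dispField_sq_mul hpZ]
    linarith

theorem dispField_neg (hsym : ∀ p : Sph n, (f (-p) : Eu n) = Refl (p : Eu n) (f p : Eu n))
    (p : Sph n) : dispField f (-p) = dispField f p := by
  rw [dispField, inner_map_neg hsym, hsym, Refl, coe_neg_sphere, dispField]
  module

/-- The derivative of the displacement at a fixed point, restricted to the tangent space. -/
def dispDeriv (f : Sph n → Sph n) (x : Sph n) : Eu n →L[ℝ] Eu n :=
  (fderiv ℝ (radialExt f) x - ContinuousLinearMap.id ℝ (Eu n)) ∘L tangentProj x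

theorem inner_fderiv_radialExt {x : Sph n} (hx : f x = x)
    (hd : DifferentiableAt ℝ (radialExt f) x) (w : Eu n) :
    ⟪(x : Eu n), fderiv ℝ (radialExt f) x w⟫ = 0 := by
  have h1 := hd.hasFDerivAt.inner ℝ hd.hasFDerivAt
  have h2 : (fun y => ⟪radialExt f y, radialExt f y⟫) = fun _ => (1 : ℝ) := by
    funext y
    rw [real_inner_self_eq_norm_sq, norm_radialExt, one_pow]
  rw [h2] at h1
  have h3 := congrArg (fun L : Eu n →L[ℝ] ℝ => L w) (h1.unique (hasFDerivAt_const _ _))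
  have h4 : ⟪radialExt f x, fderiv ℝ (radialExt f) x w⟫ +
      ⟪fderiv ℝ (radialExt f) x w, radialExt f x⟫ = 0 := h3
  rw [radialExt_coe, hx, real_inner_comm (x : Eu n)] at h4
  linarith

theorem dispDeriv_apply (x : Sph n) (p : Eu n) : dispDeriv f x p =
    fderiv ℝ (radialExt f) x (tangentProj x p) - tangentProj x p := rfl

theorem tangentProj_self (x : Sph n) : tangentProj x x = 0 := by
  rw [tangentProj_apply, inner_coe_self, one_smul, sub_self]

theorem NondegenerateFixedPoints.isCharge (hD : NondegenerateFixedPoints f) {x : Sph n}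
    (hx : f x = x) (hd : DifferentiableAt ℝ (radialExt f) x) : IsCharge x (dispDeriv f x) where
  inner_apply p := by
    rw [dispDeriv_apply, inner_sub_right, inner_tangentProj, inner_fderiv_radialExt hx hd,
      sub_zero]
  apply_self := by rw [dispDeriv_apply, tangentProj_self, map_zero, sub_zero]
  eq_smul p hp := by
    have := hD x hx _ (sub_eq_zero.1 hp)
    exact ⟨_, sub_eq_zero.1 this⟩

theorem inner_dispField_charge_eq (x : Sph n) (B : Eu n →L[ℝ] Eu n) (p : Sph n) :
    ⟪dispField f p, charge x B p⟫ = (1 - ⟪(p : Eu n), (f p : Eu n)⟫)⁻¹ * (‖B p‖ ^ 2)⁻¹ *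
      ⟪(f p : Eu n) - p, ⟪(p : Eu n), (x : Eu n)⟫ • B p - ⟪(p : Eu n), B p⟫ • (x : Eu n)⟫ := by
  have h1 : ⟪(p : Eu n), charge x B p⟫ = 0 := inner_charge_eq_zero _ _ _
  have h2 : dispField f p = (1 - ⟪(p : Eu n), (f p : Eu n)⟫)⁻¹ • (((f p : Eu n) - p) +
      (1 - ⟪(p : Eu n), (f p : Eu n)⟫) • (p : Eu n)) := by
    rw [dispField]
    module
  rw [h2, inner_smul_left, inner_add_left, inner_smul_left _ (charge x B p), h1, mul_zero,
    add_zero, charge, inner_smul_right, conj_trivial, mul_assoc]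

theorem norm_sub_sq_sph (p x : Sph n) :
    ‖(p : Eu n) - x‖ ^ 2 = 2 * (1 - ⟪(x : Eu n), (p : Eu n)⟫) := by
  rw [norm_sub_sq_real, norm_coe_sph, norm_coe_sph, real_inner_comm]
  ring

theorem norm_tangentProj_sq (p x : Sph n) :
    ‖tangentProj x p‖ ^ 2 = 1 - ⟪(x : Eu n), (p : Eu n)⟫ ^ 2 := by
  rw [tangentProj_apply, norm_sub_sq_real, norm_smul, inner_smul_right, norm_coe_sph,
    norm_coe_sph, Real.norm_eq_abs, real_inner_comm (x : Eu n) (p : Eu n), mul_one, sq_abs]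
  ring

theorem eventually_inner_pos (x : Sph n) {c : ℝ} (hc : c < 1) :
    ∀ᶠ p : Sph n in 𝓝 x, c < ⟪(x : Eu n), (p : Eu n)⟫ := by
  have h : Continuous fun p : Sph n => ⟪(x : Eu n), (p : Eu n)⟫ := by fun_prop
  exact h.continuousAt.eventually (lt_mem_nhds (by simpa only [inner_coe_self] using hc))

theorem NondegenerateFixedPoints.isBigO (hD : NondegenerateFixedPoints f) {x : Sph n}
    (hx : f x = x) :
    (fun p : Sph n => (p : Eu n) - x) =O[𝓝 x] fun p : Sph n => dispDeriv f x p := by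
  obtain ⟨K, -, hK⟩ := (fderiv ℝ (radialExt f) x -
    ContinuousLinearMap.id ℝ (Eu n)).toLinearMap.exists_antilipschitzWith (by
      refine LinearMap.ker_eq_bot'.2 fun w hw => hD x hx w ?_
      simpa [sub_eq_zero] using hw)
  refine IsBigO.of_bound (2 * K) ?_
  filter_upwards [eventually_inner_pos x zero_lt_one] with p hp
  have h1 : ‖tangentProj x p‖ ≤ K * ‖dispDeriv f x p‖ := by
    have := hK.le_mul_dist (tangentProj x p) 0
    rw [map_zero, dist_zero_right, dist_zero_right] at this
    exact this
  have h2 : ‖(p : Eu n) - x‖ ≤ 2 * ‖tangentProj x p‖ := by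
    rw [← sq_le_sq₀ (norm_nonneg _) (by positivity), mul_pow, norm_sub_sq_sph,
      norm_tangentProj_sq]
    have h3 : ⟪(x : Eu n), (p : Eu n)⟫ ≤ 1 := by
      have := real_inner_le_norm (x : Eu n) (p : Eu n)
      rwa [norm_coe_sph, norm_coe_sph, mul_one] at this
    nlinarith
  linarith

theorem NondegenerateFixedPoints.isLittleO (hD : NondegenerateFixedPoints f) {x : Sph n}
    (hx : f x = x) (hd : DifferentiableAt ℝ (radialExt f) x) :
    (fun p : Sph n => (f p : Eu n) - p - dispDeriv f x p) =o[𝓝 x]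
      fun p : Sph n => dispDeriv f x p := by
  refine IsLittleO.trans_isBigO ?_ (hD.isBigO hx)
  set L : Eu n →L[ℝ] Eu n := fderiv ℝ (radialExt f) x - ContinuousLinearMap.id ℝ (Eu n)
  have hcoe : Tendsto (fun p : Sph n => (p : Eu n)) (𝓝 x) (𝓝 (x : Eu n)) :=
    continuous_subtype_val.tendsto x
  have h1 := (hd.hasFDerivAt.sub (hasFDerivAt_id (x : Eu n))).isLittleO.comp_tendsto hcoe
  have h2 : (fun p : Sph n => (2⁻¹ * ‖(p : Eu n) - x‖ ^ 2) • L x) =o[𝓝 x]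
      fun p : Sph n => (p : Eu n) - x := by
    have h3 : (fun p : Sph n => ‖(p : Eu n) - x‖ ^ 2) =o[𝓝 x]
        fun p : Sph n => (p : Eu n) - x :=
      ((isLittleO_norm_pow_id one_lt_two).comp_tendsto
        (tendsto_sub_nhds_zero_iff.2 hcoe))
    refine (IsBigO.of_bound (2⁻¹ * ‖L x‖) (Eventually.of_forall fun p => ?_)).trans_isLittleO h3
    rw [norm_smul, norm_mul, norm_inv, Real.norm_two]
    exact (mul_right_comm _ _ _).le
  refine (h1.sub h2).congr_left fun p => ?_
  have h4 : tangentProj x p = ((p : Eu n) - x) + (2⁻¹ * ‖(p : Eu n) - x‖ ^ 2) • (x : Eu n) := by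
    rw [tangentProj_apply, norm_sub_sq_sph]
    module
  have h5 : dispDeriv f x p = L (p - x) + (2⁻¹ * ‖(p : Eu n) - x‖ ^ 2) • L x := by
    show L (tangentProj x p) = _
    rw [h4, map_add, map_smul]
  rw [h5]
  simp [hx, L]
  abel

theorem NondegenerateFixedPoints.eventually_inner_nonneg (hD : NondegenerateFixedPoints f)
    {x : Sph n} (hx : f x = x) (hd : DifferentiableAt ℝ (radialExt f) x) :
    ∀ᶠ p : Sph n in 𝓝 x, 0 ≤ ⟪dispField f p, charge x (dispDeriv f x) p⟫ := by
  filter_upwards [(hD.isLittleO hx hd).def (c := 1 / 4) (by norm_num),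
    eventually_inner_pos x (c := 1 / 2) (by norm_num)] with p hp hp'
  have hB := (hD.isCharge hx hd).inner_apply p
  rw [inner_dispField_charge_eq]
  have h1 : ⟪(p : Eu n), (f p : Eu n)⟫ ≤ 1 := by
    have := real_inner_le_norm (p : Eu n) (f p : Eu n)
    rwa [norm_coe_sph, norm_coe_sph, mul_one] at this
  have h2 : 0 ≤ (1 - ⟪(p : Eu n), (f p : Eu n)⟫)⁻¹ := inv_nonneg.2 (by linarith)
  refine mul_nonneg (mul_nonneg h2 (by positivity)) ?_
  rw [real_inner_comm (x : Eu n) (p : Eu n)]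
  have h3 : ⟪(x : Eu n), (p : Eu n)⟫ ≤ 1 := by
    have := real_inner_le_norm (x : Eu n) (p : Eu n)
    rwa [norm_coe_sph, norm_coe_sph, mul_one] at this
  set b := dispDeriv f x p
  set r := (f p : Eu n) - p - b with hr
  set α := ⟪(x : Eu n), (p : Eu n)⟫
  set U := α • b - ⟪(p : Eu n), b⟫ • (x : Eu n) with hU
  have h4 : (f p : Eu n) - p = b + r := by rw [hr]; abel
  have h5 : ⟪b, U⟫ = α * ‖b‖ ^ 2 := by
    rw [hU, inner_sub_right, inner_smul_right, inner_smul_right, real_inner_comm (x : Eu n) b,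
      hB, real_inner_self_eq_norm_sq, mul_zero, sub_zero]
  have h6 : ‖U‖ ≤ 2 * ‖b‖ := by
    have h7 : |⟪(p : Eu n), b⟫| ≤ ‖b‖ := by
      have := abs_real_inner_le_norm (p : Eu n) b
      rwa [norm_coe_sph, one_mul] at this
    refine (norm_sub_le _ _).trans ?_
    rw [norm_smul, norm_smul, norm_coe_sph, mul_one, Real.norm_eq_abs, Real.norm_eq_abs,
      abs_of_nonneg (by linarith)]
    nlinarith [norm_nonneg b]
  have h8 : -(1 / 4 * ‖b‖ * (2 * ‖b‖)) ≤ ⟪r, U⟫ := by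
    refine neg_le_of_abs_le ((abs_real_inner_le_norm r U).trans ?_)
    exact mul_le_mul hp h6 (norm_nonneg _) (by positivity)
  rw [h4, inner_add_left, h5]
  nlinarith [sq_nonneg ‖b‖]

end Displacement

section OddDimension

open Filter Topology Set
open scoped ContDiff

variable {n : ℕ}

/-- A finite symmetric subset of the sphere is generated by representatives of its antipodal
pairs. -/
theorem exists_symmPoles_eq {Z : Set (Sph n)} (hZ : Z.Finite) (hneg : ∀ p, -p ∈ Z ↔ p ∈ Z) :
    ∃ s : Finset (Sph n), (∀ x ∈ s, -x ∉ s) ∧ symmPoles s = Z := by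
  classical
  refine ⟨hZ.toFinset.filter fun x => WellOrderingRel x (-x), fun x hx hx' => ?_, ?_⟩
  · have h1 := (Finset.mem_filter.1 hx).2
    have h2 := (Finset.mem_filter.1 hx').2
    rw [neg_neg] at h2
    exact asymm h1 h2
  · ext p
    simp only [symmPoles, Finset.mem_filter, Set.Finite.mem_toFinset, neg_neg, hneg,
      Set.mem_ofPred_eq]
    rw [← and_or_left, and_iff_left_iff_imp]
    intro _
    rcases trichotomous_of WellOrderingRel p (-p) with h | h | h
    · exact Or.inl h
    · exact (ne_neg_of_mem_unit_sphere ℝ p h).elim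
    · exact Or.inr h

theorem NondegenerateFixedPoints.homotopic_id {f : C(Sph n, Sph n)}
    (hD : NondegenerateFixedPoints f) (hn : Odd n) (hn2 : 2 ≤ n)
    (hd : ∀ x : Sph n, DifferentiableAt ℝ (radialExt f) x)
    (hsym : ∀ p : Sph n, (f (-p) : Eu n) = Refl (p : Eu n) (f p : Eu n)) :
    f.Homotopic (ContinuousMap.id (Sph n)) := by
  classical
  obtain ⟨s, hs, hsZ⟩ := exists_symmPoles_eq (hD.finite f.continuous hd)
    fun p => map_neg_eq_neg_iff hsym p
  have hfix : ∀ x ∈ s, f x = x := fun x hx => by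
    have : x ∈ symmPoles s := Or.inl hx
    rwa [hsZ] at this
  set B := dispDeriv f
  have hB : ∀ x ∈ s, IsCharge x (B x) := fun x hx => hD.isCharge (hfix x hx) (hd x)
  have h₀ := polarField_dispField f.continuous
  rw [← hsZ] at h₀
  have h₁ := polarField_sum_charge s B hs hB
  have hnear : ∀ x ∈ s, ∀ z : Sph n, z = x ∨ z = -x →
      ∀ᶠ p : Sph n in 𝓝 z, 0 ≤ ⟪dispField f p, charge x (B x) p⟫ := by
    rintro x hx z (rfl | rfl)
    · exact hD.eventually_inner_nonneg (hfix z hx) (hd z)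
    · have h2 := hD.eventually_inner_nonneg (hfix x hx) (hd x)
      have h3 : Tendsto (fun p : Sph n => -p) (𝓝 (-x)) (𝓝 x) := by
        have := (continuous_neg (G := Sph n)).tendsto (-x)
        rwa [neg_neg] at this
      filter_upwards [h3.eventually h2] with p hp
      rwa [dispField_neg hsym, coe_neg_sphere, charge_neg] at hp
  have h₂ : f.Homotopic (h₁.toMap continuous_id) := by
    refine h₀.homotopic_of_inner_ge h₁ (fun z hz => ?_)
      fun p => by rw [hsZ]; exact coe_eq_polarMap_dispField p
    obtain ⟨x, hx, hzx⟩ : ∃ x ∈ s, z = x ∨ z = -x := by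
      rcases hz with hz | hz
      · exact ⟨z, hz, Or.inl rfl⟩
      · exact ⟨-z, hz, Or.inr (neg_neg z).symm⟩
    have hr := polarField_sum_charge (s.erase x) B
      (fun y hy h => hs y (Finset.mem_of_mem_erase hy) (Finset.mem_of_mem_erase h))
      fun y hy => hB y (Finset.mem_of_mem_erase hy)
    have hzr : z ∉ symmPoles (s.erase x) := fun h => by
      refine Set.disjoint_left.1 (disjoint_symmPoles (Finset.notMem_erase x s) fun h' => ?_) h hzx
      exact hs x hx (Finset.mem_of_mem_erase h')
    refine ⟨‖∑ y ∈ s.erase x, charge y (B y) z‖ + 1, nhdsWithin_le_nhds ?_⟩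
    filter_upwards [hnear x hx z hzx, (hr.continuousAt hzr).norm.eventually
      (gt_mem_nhds (lt_add_one _))] with p hp hp'
    rw [← Finset.add_sum_erase s _ hx, inner_add_right]
    have h3 := abs_real_inner_le_norm (dispField f p) (∑ y ∈ s.erase x, charge y (B y) p)
    have h4 := (abs_le.1 h3).1
    have h5 := mul_le_mul_of_nonneg_left hp'.le (norm_nonneg (dispField f p))
    linarith
  let ng : C(Sph n, Sph n) := ⟨fun p => -p, continuous_neg⟩
  exact (h₂.trans (homotopic_neg_of_sum_charge hn hn2 B (g₁ := ng) (fun _ => rfl) s hs hB _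
    fun _ => rfl)).trans (homotopic_neg_id hn fun _ => rfl)

end OddDimension

/-- A smooth map `f : S^n → S^n` (`n ≥ 2`) satisfying `f(-p) = R_p f(p)`,
all of whose fixed points are nondegenerate (`T_x f - I` is an isomorphism of `T_x S^n`),
is not homotopic to a constant map; if moreover `n` is odd, it is homotopic to the identity. -/
theorem smooth_reflection_symmetric_map_not_nullhomotopic (n : ℕ) (hn : 2 ≤ n)
    [Fact (Module.finrank ℝ (Eu n) = n + 1)]
    (f : Sph n → Sph n) (hf : ContMDiff (𝓡 n) (𝓡 n) (⊤ : ℕ∞) f)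
    (hsym : ∀ p : Sph n, (f (-p) : Eu n) = Refl (p : Eu n) (f p : Eu n))
    (hfix : ∀ x : Sph n, f x = x →
      Function.Bijective
        (fun v : EuclideanSpace ℝ (Fin n) =>
          (show EuclideanSpace ℝ (Fin n) from
            mfderiv (𝓡 n) (𝓡 n) f x (show TangentSpace (𝓡 n) x from v)) - v)) :
    (∀ y : Sph n,
        ¬ (ContinuousMap.mk f hf.continuous).Homotopic (ContinuousMap.const (Sph n) y)) ∧
      (Odd n →
        (ContinuousMap.mk f hf.continuous).Homotopic (ContinuousMap.id (Sph n))) := by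
  have hD : NondegenerateFixedPoints f := fun x hx w hw =>
    eq_zero_of_fderiv_comp_radialProj_eq hf hx (hfix x hx).injective hw
  have hd : ∀ x : Eu n, x ≠ 0 → ContDiffAt ℝ (⊤ : ℕ∞) (radialExt f) x := fun x hx =>
    contDiffAt_comp_radialProj hf hx
  refine ⟨NondegenerateFixedPoints.not_homotopic_const (f := ⟨f, hf.continuous⟩) hD hd hsym,
    fun hodd => NondegenerateFixedPoints.homotopic_id (f := ⟨f, hf.continuous⟩) hD hodd hn
      (fun x => (hd x (coe_sph_ne_zero x)).differentiableAt (by simp)) hsym⟩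

end
end

section
/- Let f : S^n → S^n be a smooth map satisfying f(−p) = R_p f(p) for all p ∈ S^n. Then x ∈ S^n is a fixed point of f if and only if −x is a fixed point of f, and at any fixed point x one has T_{−x} f − I = −(T_x f − I) under the canonical identification T_x S^n = T_{−x} S^n = x^⊥. -/
open Metric
open scoped RealInnerProductSpace Manifold

noncomputable section

/-- The differential of the inclusion `S^n ↪ ℝ^{n+1}` at `x`; it identifies the abstract
tangent space `T_x S^n` with the hyperplane `x^⊥ ⊆ ℝ^{n+1}`. -/
def inclDiff (n : ℕ) [Fact (Module.finrank ℝ (Eu n) = n + 1)] (x : Sph n) :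
    TangentSpace (𝓡 n) x →L[ℝ] Eu n :=
  mfderiv (𝓡 n) 𝓘(ℝ, Eu n) (fun y : Sph n => (y : Eu n)) x

/-- A reflection maps its own unit normal vector to the opposite vector. -/
lemma Refl_self {n : ℕ} {p : Eu n} (hp : ‖p‖ = 1) : Refl p p = -p := by
  rw [Refl, real_inner_self_eq_norm_sq, hp]
  module

/-- The derivative of `y ↦ R_{a y}(b y)` for maps `a`, `b` from a manifold to Euclidean space. -/
lemma HasMFDerivAt.Refl {n : ℕ} {E H M : Type*} [NormedAddCommGroup E] [NormedSpace ℝ E]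
    [TopologicalSpace H] {I : ModelWithCorners ℝ E H} [TopologicalSpace M] [ChartedSpace H M]
    {a b : M → Eu n} {x : M} {a' b' : TangentSpace I x →L[ℝ] Eu n}
    (ha : HasMFDerivAt I 𝓘(ℝ, Eu n) a x a') (hb : HasMFDerivAt I 𝓘(ℝ, Eu n) b x b') :
    ∃ c' : TangentSpace I x →L[ℝ] Eu n,
      HasMFDerivAt I 𝓘(ℝ, Eu n) (fun y => Refl (a y) (b y)) x c' ∧
      ∀ v, c' v = b' v - ((2 * ⟪a x, b x⟫) • a' v +
        (2 * (⟪a x, b' v⟫ + ⟪a' v, b x⟫)) • a x) := by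
  have hΦ : HasFDerivAt (fun q : Eu n × Eu n => _root_.Refl q.1 q.2) _ (a x, b x) :=
    hasFDerivAt_snd.sub
      (((hasFDerivAt_fst.inner ℝ hasFDerivAt_snd).const_mul 2).smul hasFDerivAt_fst)
  have hab : HasMFDerivAt I 𝓘(ℝ, Eu n × Eu n) (fun y => (a y, b y)) x (a'.prod b') :=
    ⟨ha.1.prodMk hb.1, ha.2.prodMk hb.2⟩
  refine ⟨_, HasMFDerivAt.comp x (f := fun y => (a y, b y)) hΦ.hasMFDerivAt hab, fun v => ?_⟩
  rfl

lemma hasMFDerivAt_neg_sphere {n : ℕ} (x : Sph n) :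
    HasMFDerivAt (𝓡 n) (𝓡 n) (fun y : Sph n => -y) x
      (mfderiv (𝓡 n) (𝓡 n) (fun y : Sph n => -y) x) :=
  have : Fact (Module.finrank ℝ (Eu n) = n + 1) := ⟨finrank_euclideanSpace_fin⟩
  ((contMDiff_neg_sphere (m := 1) x).mdifferentiableAt one_ne_zero).hasMFDerivAt

section Sphere

variable {n : ℕ} [Fact (Module.finrank ℝ (Eu n) = n + 1)]

lemma hasMFDerivAt_coe_sphere (x : Sph n) :
    HasMFDerivAt (𝓡 n) 𝓘(ℝ, Eu n) (fun y : Sph n => (y : Eu n)) x (inclDiff n x) :=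
  ((contMDiff_coe_sphere (m := 1) x).mdifferentiableAt one_ne_zero).hasMFDerivAt

lemma inclDiff_injective (x : Sph n) : Function.Injective (inclDiff n x) :=
  injective_mvfderiv_subtypeVal_sphere x

lemma inner_inclDiff (x : Sph n) (v : TangentSpace (𝓡 n) x) :
    ⟪(x : Eu n), inclDiff n x v⟫ = 0 := by
  have h : inclDiff n x v ∈ (ℝ ∙ (x : Eu n))ᗮ := by
    rw [← range_mvfderiv_subtypeVal (n := n) x]
    exact ⟨v, rfl⟩
  exact Submodule.mem_orthogonal_singleton_iff_inner_right.1 h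

/-- Under the inclusion of the sphere, the differential of the antipodal map is `-I`. -/
lemma inclDiff_mfderiv_neg (x : Sph n) (v : TangentSpace (𝓡 n) x) :
    inclDiff n (-x) (mfderiv (𝓡 n) (𝓡 n) (fun y : Sph n => -y) x v) = -inclDiff n x v :=
  congrArg (fun L : TangentSpace (𝓡 n) x →L[ℝ] Eu n => L v)
    (hasMFDerivAt_unique ((hasMFDerivAt_coe_sphere (-x)).comp x (hasMFDerivAt_neg_sphere x))
      (hasMFDerivAt_coe_sphere x).neg)

/-- The differential of the antipodal map sends a tangent vector to the opposite of the tangent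
vector at the antipode with the same image in Euclidean space. -/
lemma mfderiv_neg_sphere_eq {x : Sph n} {v : TangentSpace (𝓡 n) x}
    {u : TangentSpace (𝓡 n) (-x)} (h : inclDiff n x v = inclDiff n (-x) u) :
    mfderiv (𝓡 n) (𝓡 n) (fun y : Sph n => -y) x v = -u := by
  apply inclDiff_injective (-x)
  rw [inclDiff_mfderiv_neg, h]
  exact (map_neg (inclDiff n (-x)) u).symm

end Sphere

/-- For a smooth `f : S^n → S^n` with `f(-p) = R_p f(p)`, `x` is a fixed
point iff `-x` is one, and at a fixed point `x` one has `T_{-x}f - I = -(T_x f - I)` under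
the canonical identification `T_x S^n = T_{-x} S^n = x^⊥` (realized here by the differentials
of the inclusion `S^n ↪ ℝ^{n+1}`). -/
theorem fixed_points_of_reflection_symmetric_map (n : ℕ) (hn : 1 ≤ n)
    [Fact (Module.finrank ℝ (Eu n) = n + 1)]
    (f : Sph n → Sph n) (hf : ContMDiff (𝓡 n) (𝓡 n) (⊤ : ℕ∞) f)
    (hsym : ∀ p : Sph n, (f (-p) : Eu n) = Refl (p : Eu n) (f p : Eu n)) :
    (∀ x : Sph n, f x = x ↔ f (-x) = -x) ∧
      (∀ x : Sph n, f x = x →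
        ∀ (v : TangentSpace (𝓡 n) x) (u : TangentSpace (𝓡 n) (-x)),
          inclDiff n x v = inclDiff n (-x) u →
            inclDiff n (f (-x)) (mfderiv (𝓡 n) (𝓡 n) f (-x) u) - inclDiff n (-x) u =
              -(inclDiff n (f x) (mfderiv (𝓡 n) (𝓡 n) f x v) - inclDiff n x v)) := by
  refine ⟨fun x => ⟨fun h => ?_, fun h => ?_⟩, fun x hx v u hvu => ?_⟩
  · apply Subtype.ext
    rw [hsym, h, Refl_self (norm_eq_of_mem_sphere x)]
    rfl
  · apply Subtype.ext
    have hs := hsym (-x)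
    rw [h, Refl_self (norm_eq_of_mem_sphere (-x)), neg_neg] at hs
    simpa using hs
  · have hfd (y : Sph n) : HasMFDerivAt (𝓡 n) (𝓡 n) f y (mfderiv (𝓡 n) (𝓡 n) f y) :=
      ((hf y).mdifferentiableAt (by simp)).hasMFDerivAt
    have hιf (y : Sph n) := (hasMFDerivAt_coe_sphere (f y)).comp y (hfd y)
    obtain ⟨c', hc, hc'⟩ := (hasMFDerivAt_coe_sphere x).Refl (hιf x)
    have hneg := (hιf (-x)).comp x (hasMFDerivAt_neg_sphere x)
    have hfun : ((fun y : Sph n => (y : Eu n)) ∘ f) ∘ (fun y : Sph n => -y) =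
        fun y : Sph n => Refl (y : Eu n) (((fun y : Sph n => (y : Eu n)) ∘ f) y) :=
      funext hsym
    rw [hfun] at hneg
    have key : inclDiff n (f (-x)) (mfderiv (𝓡 n) (𝓡 n) f (-x)
        (mfderiv (𝓡 n) (𝓡 n) (fun y : Sph n => -y) x v)) = c' v :=
      congrArg (fun L : TangentSpace (𝓡 n) x →L[ℝ] Eu n => L v) (hasMFDerivAt_unique hneg hc)
    have hA : ⟪(x : Eu n), inclDiff n (f x) (mfderiv (𝓡 n) (𝓡 n) f x v)⟫ = 0 := by
      have h := inner_inclDiff (f x) (mfderiv (𝓡 n) (𝓡 n) f x v)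
      rwa [congrArg Subtype.val hx] at h
    have hV : ⟪inclDiff n x v, (x : Eu n)⟫ = 0 := by
      rw [real_inner_comm, inner_inclDiff]
    have hc'' : c' v = inclDiff n (f x) (mfderiv (𝓡 n) (𝓡 n) f x v) -
        ((2 * ⟪(x : Eu n), (f x : Eu n)⟫) • inclDiff n x v +
          (2 * (⟪(x : Eu n), inclDiff n (f x) (mfderiv (𝓡 n) (𝓡 n) f x v)⟫ +
            ⟪inclDiff n x v, (f x : Eu n)⟫)) • (x : Eu n)) := hc' v
    rw [hA, congrArg Subtype.val hx, hV, real_inner_self_eq_norm_sq,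
      norm_eq_of_mem_sphere x] at hc''
    rw [mfderiv_neg_sphere_eq hvu, hc'', map_neg, map_neg] at key
    rw [← hvu, neg_eq_iff_eq_neg.1 key]
    module

end
end

section
/- Let n ≥ 2 and let f : S^n → S^n be a continuous map satisfying f(−p) = R_p f(p) for all p ∈ S^n. Then there exists a smooth map g : S^n → S^n, homotopic to f, satisfying g(−p) = R_p g(p) for all p, and such that for every fixed point x of g the map T_x g − I : T_x S^n → T_x S^n is an isomorphism. -/
open Metric
open scoped RealInnerProductSpace Manifold

noncomputable section

theorem Refl_neg_left {n : ℕ} (p x : Eu n) : Refl (-p) x = Refl p x := by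
  simp [Refl]

theorem Refl_add {n : ℕ} (p x y : Eu n) : Refl p (x + y) = Refl p x + Refl p y := by
  simp only [Refl, inner_add_right]
  module

theorem Refl_smul {n : ℕ} (p : Eu n) (r : ℝ) (x : Eu n) : Refl p (r • x) = r • Refl p x := by
  simp only [Refl, inner_smul_right]
  module

theorem norm_Refl {n : ℕ} {p : Eu n} (hp : ‖p‖ = 1) (x : Eu n) : ‖Refl p x‖ = ‖x‖ := by
  have hpp : ⟪p, p⟫ = 1 := by rw [real_inner_self_eq_norm_sq, hp, one_pow]
  rw [← sq_eq_sq₀ (norm_nonneg _) (norm_nonneg _), ← real_inner_self_eq_norm_sq,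
    ← real_inner_self_eq_norm_sq]
  simp only [Refl, inner_sub_left, inner_sub_right, real_inner_smul_left, real_inner_smul_right,
    hpp, real_inner_comm x p]
  ring

theorem Refl_Refl {n : ℕ} {p : Eu n} (hp : ‖p‖ = 1) (x : Eu n) : Refl p (Refl p x) = x := by
  have hpp : ⟪p, p⟫ = 1 := by rw [real_inner_self_eq_norm_sq, hp, one_pow]
  simp only [Refl, inner_sub_right, real_inner_smul_right, hpp]
  module

/-- A continuous map from the sphere to the ambient space is uniformly approximated by
restrictions of smooth maps. -/
theorem exists_contDiff_dist_lt_on_sphere {n : ℕ} {f : Sph n → Eu n} (hf : Continuous f)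
    {ε : ℝ} (hε : 0 < ε) :
    ∃ F : Eu n → Eu n, ContDiff ℝ (⊤ : ℕ∞) F ∧ ∀ p : Sph n, dist (F p) (f p) < ε := by
  let t : Eu n → Set (Eu n) := fun x => {y | ∀ hx : x ∈ sphere (0 : Eu n) 1, dist y (f ⟨x, hx⟩) < ε}
  have ht : ∀ x, Convex ℝ (t x) := by
    intro x
    by_cases hx : x ∈ sphere (0 : Eu n) 1
    · have : t x = ball (f ⟨x, hx⟩) ε := by
        ext y; exact ⟨fun h => h hx, fun h _ => h⟩
      rw [this]
      exact convex_ball _ _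
    · have : t x = Set.univ := by
        ext y; exact ⟨fun _ => trivial, fun _ h => absurd h hx⟩
      rw [this]
      exact convex_univ
  have hloc : ∀ x : Eu n, ∃ c : Eu n, ∀ᶠ y in nhds x, c ∈ t y := by
    intro x
    by_cases hx : x ∈ sphere (0 : Eu n) 1
    · refine ⟨f ⟨x, hx⟩, ?_⟩
      have hc : ∀ᶠ q : Sph n in nhds ⟨x, hx⟩, dist (f ⟨x, hx⟩) (f q) < ε := by
        filter_upwards [Metric.tendsto_nhds.1 (hf.tendsto ⟨x, hx⟩) ε hε] with q hq
        rwa [dist_comm]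
      rw [nhds_subtype_eq_comap, Filter.eventually_comap] at hc
      filter_upwards [hc] with y hy hy'
      exact hy ⟨y, hy'⟩ rfl
    · refine ⟨0, ?_⟩
      filter_upwards [isClosed_sphere.isOpen_compl.mem_nhds hx] with y hy hy'
      exact absurd hy' hy
  obtain ⟨F, hF⟩ := exists_contMDiffMap_forall_mem_convex_of_local_const (n := (⊤ : ℕ∞))
    (modelWithCornersSelf ℝ (Eu n)) ht hloc
  exact ⟨F, F.contMDiff.contDiff, fun p => hF p p.2⟩

/-- A map of the sphere with the reflection symmetry is uniformly approximated by a smooth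
degree-zero homogeneous map with the same symmetry. -/
theorem exists_homogeneous_symmetric_approx {n : ℕ} (f : C(Sph n, Sph n))
    (hsym : ∀ p : Sph n, (f (-p) : Eu n) = Refl (p : Eu n) (f p : Eu n))
    {ε : ℝ} (hε : 0 < ε) :
    ∃ G : Eu n → Eu n, (∀ x, x ≠ 0 → ContDiffAt ℝ (⊤ : ℕ∞) G x) ∧
      (∀ r : ℝ, 0 < r → ∀ x, G (r • x) = G x) ∧
      (∀ p : Sph n, G (-p) = Refl (p : Eu n) (G p)) ∧
      ∀ p : Sph n, ‖G p - f p‖ < ε := by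
  obtain ⟨F, hF, hFf⟩ :=
    exists_contDiff_dist_lt_on_sphere (continuous_subtype_val.comp f.continuous) hε
  let u : Eu n → Eu n := fun x => ‖x‖⁻¹ • x
  have hu : ∀ p : Sph n, u p = p := fun p => by simp [u]
  have hun : ∀ x, u (-x) = -u x := fun x => by simp [u]
  have husmooth : ∀ x, x ≠ 0 → ContDiffAt ℝ (⊤ : ℕ∞) u x := fun x hx =>
    ((contDiffAt_norm ℝ hx).inv (norm_ne_zero_iff.2 hx)).smul contDiffAt_id
  refine ⟨fun x => (2⁻¹ : ℝ) • (F (u x) + Refl (u x) (F (-u x))), ?_, ?_, ?_, ?_⟩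
  · intro x hx
    have h1 := husmooth x hx
    have h2 : ContDiffAt ℝ (⊤ : ℕ∞) (fun y => F (u y)) x := hF.contDiffAt.comp x h1
    have h3 : ContDiffAt ℝ (⊤ : ℕ∞) (fun y => F (-u y)) x := hF.contDiffAt.comp x h1.neg
    exact (contDiffAt_const (c := (2⁻¹ : ℝ))).smul
      (h2.add (h3.sub ((contDiffAt_const.mul (h1.inner ℝ h3)).smul h1)))
  · intro r hr x
    have : u (r • x) = u x := by
      simp only [u, norm_smul, Real.norm_of_nonneg hr.le, smul_smul]
      congr 1
      field_simp
    simp only [this]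
  · intro p
    have hp : ‖(p : Eu n)‖ = 1 := by simp
    simp only [hun, hu, neg_neg, Refl_neg_left, Refl_smul, Refl_add, Refl_Refl hp]
    exact congrArg _ (add_comm _ _)
  · intro p
    have hp : ‖(p : Eu n)‖ = 1 := by simp
    simp only [hu]
    have h1 : ‖F p - f p‖ < ε := by rw [← dist_eq_norm]; exact hFf p
    have h2 : ‖Refl (p : Eu n) (F (-p) - f (-p))‖ < ε := by
      rw [norm_Refl hp, ← dist_eq_norm]; exact hFf (-p)
    have h3 : Refl (p : Eu n) (F (-p)) = Refl (p : Eu n) (F (-p) - f (-p)) + f p := by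
      rw [← Refl_Refl hp (f p : Eu n), ← hsym, ← Refl_add, sub_add_cancel]
    rw [h3]
    calc _ = ‖(2⁻¹ : ℝ) • ((F p - f p) + Refl (p : Eu n) (F (-p) - f (-p)))‖ := by
          congr 1; module
      _ ≤ 2⁻¹ * (‖F p - f p‖ + ‖Refl (p : Eu n) (F (-p) - f (-p))‖) := by
          rw [norm_smul, Real.norm_of_nonneg (by norm_num)]
          gcongr
          exact norm_add_le _ _
      _ < ε := by linarith

/-- Sard's theorem for `x ↦ x - G x`: arbitrarily small regular values exist. -/
theorem exists_small_regular_value {E : Type*} [NormedAddCommGroup E] [NormedSpace ℝ E]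
    [FiniteDimensional ℝ E] {G : E → E} (hG : ∀ x, x ≠ 0 → DifferentiableAt ℝ G x)
    {ε : ℝ} (hε : 0 < ε) :
    ∃ c : E, ‖c‖ < ε ∧ ∀ x, x ≠ 0 → x - G x = c → ∀ v, fderiv ℝ G x v = v → v = 0 := by
  borelize E
  let μ : MeasureTheory.Measure E := MeasureTheory.Measure.addHaar
  let D : E → E →L[ℝ] E := fun x => ContinuousLinearMap.id ℝ E - fderiv ℝ G x
  let s : Set E := {x | x ≠ 0 ∧ (D x).det = 0}
  have hs : μ ((fun x => x - G x) '' s) = 0 :=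
    MeasureTheory.addHaar_image_eq_zero_of_det_fderivWithin_eq_zero μ
      (fun x hx => ((hasFDerivAt_id x).sub (hG x hx.1).hasFDerivAt).hasFDerivWithinAt)
      (fun x hx => hx.2)
  have hb : ¬ ball (0 : E) ε ⊆ (fun x => x - G x) '' s := fun h =>
    (measure_ball_pos μ (0 : E) hε).ne' (MeasureTheory.measure_mono_null h hs)
  obtain ⟨c, hc, hcs⟩ := Set.not_subset.1 hb
  refine ⟨c, by simpa using hc, fun x hx hxc v hv => ?_⟩
  have hdet : (D x).det ≠ 0 := fun h => hcs ⟨x, ⟨hx, h⟩, hxc⟩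
  by_contra hv0
  refine hdet (LinearMap.det_eq_zero_iff_ker_ne_bot.2 fun hker => hv0 ?_)
  have : v ∈ LinearMap.ker ((D x : E →L[ℝ] E) : E →ₗ[ℝ] E) := by simp [D, hv]
  rwa [hker, Submodule.mem_bot] at this

/-- The radial projection of a small perturbation of a sphere-valued map is homotopic to it. -/
theorem homotopic_of_norm_sub_lt_one {X E : Type*} [TopologicalSpace X] [NormedAddCommGroup E]
    [NormedSpace ℝ E] {f g : C(X, sphere (0 : E) 1)} {h : X → E} (hc : Continuous h)
    (hf : ∀ p, ‖h p - f p‖ < 1) (hg : ∀ p, (g p : E) = ‖h p‖⁻¹ • h p) :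
    g.Homotopic f := by
  let k : unitInterval × X → E := fun q => h q.2 + (q.1 : ℝ) • (f q.2 - h q.2)
  have hkc : Continuous k := by fun_prop
  have hk0 : ∀ q, k q ≠ 0 := by
    intro q hq
    have h1 : (f q.2 : E) = (1 - (q.1 : ℝ)) • (f q.2 - h q.2) + k q := by
      simp only [k]; module
    have h2 : ‖(f q.2 : E)‖ = 1 := by simp
    rw [h1, hq, add_zero, norm_smul, Real.norm_of_nonneg (sub_nonneg.2 q.1.2.2),
      norm_sub_rev] at h2
    have h3 := hf q.2
    have h4 := q.1.2.1
    nlinarith [norm_nonneg (h q.2 - f q.2)]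
  refine ⟨⟨⟨fun q => ⟨‖k q‖⁻¹ • k q, ?_⟩, ?_⟩, ?_, ?_⟩⟩
  · simp [norm_smul, hk0 q]
  · exact Continuous.subtype_mk
      ((hkc.norm.inv₀ fun q => norm_ne_zero_iff.2 (hk0 q)).smul hkc) _
  · intro p
    ext1
    simp [k, hg]
  · intro p
    ext1
    simp [k]

/-- The derivative of a map equals, up to radial terms, that of its radial projection. -/
theorem fderiv_eq_add_smul_of_normalize {E : Type*} [NormedAddCommGroup E]
    [InnerProductSpace ℝ E] {H : E → E} {p v : E} (hH : DifferentiableAt ℝ H p) (h0 : H p ≠ 0)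
    (hp : ‖H p‖⁻¹ • H p = p) (hv : fderiv ℝ (fun x => ‖H x‖⁻¹ • H x) p v = v) :
    ∃ s : ℝ, fderiv ℝ H p v = ‖H p‖ • v + s • p := by
  have hn : DifferentiableAt ℝ (fun x => ‖H x‖) p := hH.norm ℝ h0
  have hN : DifferentiableAt ℝ (fun x => ‖H x‖⁻¹ • H x) p :=
    (hn.inv (norm_ne_zero_iff.2 h0)).smul hH
  have heq : H = fun x => ‖H x‖ • (‖H x‖⁻¹ • H x) := by
    ext1 x
    by_cases hx : H x = 0
    · simp [hx]
    · rw [smul_inv_smul₀ (norm_ne_zero_iff.2 hx)]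
  refine ⟨fderiv ℝ (fun x => ‖H x‖) p v, ?_⟩
  conv_lhs => rw [heq]
  rw [(hn.hasFDerivAt.fun_smul hN.hasFDerivAt).fderiv]
  simp [hv, hp]

/-- For a degree-zero homogeneous `G` and a regular value `c` of `x ↦ x - G x`, the radial
projection of `x ↦ G x + c - ⟪c, x⟫ x` has no nonzero tangent vector fixed by its derivative at
a fixed point. -/
theorem eq_zero_of_fderiv_normalize_eq {E : Type*} [NormedAddCommGroup E]
    [InnerProductSpace ℝ E] {G : E → E} (hG : ∀ x, x ≠ 0 → DifferentiableAt ℝ G x)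
    (hhom : ∀ r : ℝ, 0 < r → ∀ x, G (r • x) = G x) {c : E}
    (hc : ∀ x, x ≠ 0 → x - G x = c → ∀ v, fderiv ℝ G x v = v → v = 0)
    {H : E → E} (hHdef : H = fun x => G x + c - ⟪c, x⟫ • x)
    {p v : E} (hp1 : ‖p‖ = 1) (h0 : H p ≠ 0) (hpos : 0 < ‖H p‖ + ⟪c, p⟫)
    (hp : ‖H p‖⁻¹ • H p = p) (hpv : ⟪p, v⟫ = 0)
    (hv : fderiv ℝ (fun x => ‖H x‖⁻¹ • H x) p v = v) : v = 0 := by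
  have hp0 : p ≠ 0 := norm_ne_zero_iff.1 (by rw [hp1]; exact one_ne_zero)
  have hinner : HasFDerivAt (fun x : E => ⟪c, x⟫) (innerSL ℝ c) p :=
    (innerSL ℝ c).hasFDerivAt
  have hHd := ((hG p hp0).hasFDerivAt.add_const c).fun_sub (hinner.fun_smul (hasFDerivAt_id p))
  simp only [id] at hHd
  rw [← hHdef] at hHd
  obtain ⟨s, hs⟩ := fderiv_eq_add_smul_of_normalize hHd.differentiableAt h0 hp hv
  rw [hHd.fderiv] at hs
  simp only [sub_apply, add_apply, smul_apply, ContinuousLinearMap.smulRight_apply,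
    innerSL_apply_apply, ContinuousLinearMap.id_apply] at hs
  set l : ℝ := ‖H p‖ + ⟪c, p⟫ with hl
  have hlp : l • p ≠ 0 := smul_ne_zero hpos.ne' hp0
  have hdG : fderiv ℝ G p v = l • v + (s + ⟪c, v⟫) • p := by
    rw [sub_eq_iff_eq_add] at hs
    rw [hs, hl]; module
  have hscale : ∀ w, l • fderiv ℝ G (l • p) w = fderiv ℝ G p w := by
    intro w
    have h1 : HasFDerivAt (fun x => G (l • x)) _ p :=
      (hG _ hlp).hasFDerivAt.comp p ((hasFDerivAt_id p).const_smul l)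
    rw [funext (hhom l hpos)] at h1
    rw [h1.fderiv]
    simp
  have hradial : fderiv ℝ G (l • p) p = 0 := by
    have h1 : fderiv ℝ G p p = 0 := by
      have h2 : HasDerivAt (fun t : ℝ => t • p) p 1 := by
        simpa using (hasDerivAt_id (1 : ℝ)).smul_const p
      have h3 : HasDerivAt (fun t : ℝ => G (t • p)) (fderiv ℝ G p p) 1 := by
        have h4 : HasFDerivAt G (fderiv ℝ G p) ((1 : ℝ) • p) := by
          rw [one_smul]; exact (hG p hp0).hasFDerivAt
        exact h4.comp_hasDerivAt (1 : ℝ) h2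
      refine h3.unique ((hasDerivAt_const (1 : ℝ) (G p)).congr_of_eventuallyEq ?_)
      filter_upwards [lt_mem_nhds (zero_lt_one (α := ℝ))] with t ht using hhom t ht p
    have h5 := hscale p
    rw [h1] at h5
    exact (smul_eq_zero.1 h5).resolve_left hpos.ne'
  have hval : l • p - G (l • p) = c := by
    have h1 : H p = ‖H p‖ • p :=
      (inv_smul_eq_iff₀ (norm_ne_zero_iff.2 h0)).1 hp
    have h2 : G p + c - ⟪c, p⟫ • p = ‖H p‖ • p := by rw [← h1, hHdef]
    rw [sub_eq_iff_eq_add] at h2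
    rw [hhom l hpos, hl, add_smul, ← h2]
    abel
  have hw := hc (l • p) hlp hval (v + (l⁻¹ * (s + ⟪c, v⟫)) • p) (by
    rw [map_add, map_smul, hradial, smul_zero, add_zero,
      ← inv_smul_smul₀ hpos.ne' (fderiv ℝ G (l • p) v), hscale, hdG, smul_add,
      inv_smul_smul₀ hpos.ne', smul_smul])
  have h6 := congrArg (fun w => ⟪w, v⟫) hw
  simpa [inner_add_left, real_inner_smul_left, hpv] using h6

/-- A fixed point of a self-map of the sphere is nondegenerate as soon as the derivative of an
ambient extension fixes no nonzero tangent vector. -/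
theorem bijective_mfderiv_sub_id_of_extension {n : ℕ} [Fact (Module.finrank ℝ (Eu n) = n + 1)]
    {g : Sph n → Sph n} {K : Eu n → Eu n} {x : Sph n} (hg : MDifferentiableAt (𝓡 n) (𝓡 n) g x)
    (hK : DifferentiableAt ℝ K x) (hgK : ∀ p : Sph n, (g p : Eu n) = K p) (hx : g x = x)
    (hinj : ∀ v : Eu n, ⟪(x : Eu n), v⟫ = 0 → fderiv ℝ K x v = v → v = 0) :
    Function.Bijective
      (fun v : EuclideanSpace ℝ (Fin n) =>
        (show EuclideanSpace ℝ (Fin n) from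
          mfderiv (𝓡 n) (𝓡 n) g x (show TangentSpace (𝓡 n) x from v)) - v) := by
  let A : EuclideanSpace ℝ (Fin n) →L[ℝ] EuclideanSpace ℝ (Fin n) := mfderiv (𝓡 n) (𝓡 n) g x
  let ι : Sph n → EuclideanSpace ℝ (Fin n) →L[ℝ] Eu n := fun y =>
    mfderiv (𝓡 n) 𝓘(ℝ, Eu n) ((↑) : Sph n → Eu n) y
  have hι : ∀ y : Sph n, HasMFDerivAt (𝓡 n) 𝓘(ℝ, Eu n) ((↑) : Sph n → Eu n) y (ι y) := fun y =>
    ((contMDiff_coe_sphere (m := 1) y).mdifferentiableAt one_ne_zero).hasMFDerivAt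
  have h1 : HasMFDerivAt (𝓡 n) 𝓘(ℝ, Eu n) (fun p => (g p : Eu n)) x ((ι (g x)).comp A) :=
    (hι (g x)).comp x hg.hasMFDerivAt
  have h2 : HasMFDerivAt (𝓡 n) 𝓘(ℝ, Eu n) (fun p => (g p : Eu n)) x
      ((fderiv ℝ K x).comp (ι x)) := by
    rw [funext hgK]
    exact hK.hasFDerivAt.hasMFDerivAt.comp x (hι x)
  have h3 : (ι (g x)).comp A = (fderiv ℝ K x).comp (ι x) := hasMFDerivAt_unique h1 h2
  rw [hx] at h3
  have hιinj : Function.Injective (ι x) := injective_mvfderiv_subtypeVal_sphere x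
  have hιperp : ∀ v, ⟪(x : Eu n), ι x v⟫ = 0 := fun v =>
    Submodule.mem_orthogonal_singleton_iff_inner_right.1 (by
      rw [← range_mvfderiv_subtypeVal (n := n) x]
      exact ⟨v, rfl⟩)
  let L : EuclideanSpace ℝ (Fin n) →ₗ[ℝ] EuclideanSpace ℝ (Fin n) :=
    (A - ContinuousLinearMap.id ℝ _ : EuclideanSpace ℝ (Fin n) →L[ℝ] EuclideanSpace ℝ (Fin n))
  have hL : Function.Injective L := by
    rw [← LinearMap.ker_eq_bot, LinearMap.ker_eq_bot']
    intro v hv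
    have hAv : A v = v := sub_eq_zero.1 hv
    have h4 : ι x (A v) = fderiv ℝ K x (ι x v) := congrArg (fun B => B v) h3
    rw [hAv] at h4
    exact hιinj ((hinj _ (hιperp v) h4.symm).trans (map_zero _).symm)
  exact ⟨hL, LinearMap.injective_iff_surjective.1 hL⟩

/-- Every continuous `f : S^n → S^n` (`n ≥ 2`) with `f(-p) = R_p f(p)` is
homotopic to a smooth map `g` with the same symmetry, all of whose fixed points are
nondegenerate (`T_x g - I` is an isomorphism). -/
theorem exists_smooth_transverse_homotopic (n : ℕ) (hn : 2 ≤ n)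
    [Fact (Module.finrank ℝ (Eu n) = n + 1)]
    (f : C(Sph n, Sph n))
    (hsym : ∀ p : Sph n, (f (-p) : Eu n) = Refl (p : Eu n) (f p : Eu n)) :
    ∃ (g : Sph n → Sph n) (hg : ContMDiff (𝓡 n) (𝓡 n) (⊤ : ℕ∞) g),
      (ContinuousMap.mk g hg.continuous).Homotopic f ∧
      (∀ p : Sph n, (g (-p) : Eu n) = Refl (p : Eu n) (g p : Eu n)) ∧
      (∀ x : Sph n, g x = x →
        Function.Bijective
          (fun v : EuclideanSpace ℝ (Fin n) =>
            (show EuclideanSpace ℝ (Fin n) from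
              mfderiv (𝓡 n) (𝓡 n) g x (show TangentSpace (𝓡 n) x from v)) - v)) := by
  obtain ⟨G, hGs, hGhom, hGsym, hGf⟩ :=
    exists_homogeneous_symmetric_approx f hsym (ε := 1 / 8) (by norm_num)
  have hGd : ∀ x, x ≠ 0 → DifferentiableAt ℝ G x := fun x hx =>
    (hGs x hx).differentiableAt (by simp)
  obtain ⟨c, hcε, hc⟩ := exists_small_regular_value hGd (ε := 1 / 8) (by norm_num)
  have hnorm : ∀ p : Sph n, ‖(p : Eu n)‖ = 1 := fun p => by simp
  have hne : ∀ p : Sph n, (p : Eu n) ≠ 0 := fun p => ne_zero_of_mem_unit_sphere p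
  have hcp : ∀ p : Sph n, |⟪c, (p : Eu n)⟫| < 1 / 8 := fun p =>
    (abs_real_inner_le_norm c p).trans_lt (by rwa [hnorm, mul_one])
  let H : Eu n → Eu n := fun x => G x + c - ⟪c, x⟫ • x
  have hHf : ∀ p : Sph n, ‖H p - f p‖ < 1 / 2 := by
    intro p
    have h1 : H p - f p = (G p - f p) + c - ⟪c, (p : Eu n)⟫ • (p : Eu n) := by
      simp only [H]; abel
    have h2 := norm_sub_le ((G p - f p) + c) (⟪c, (p : Eu n)⟫ • (p : Eu n))
    have h3 := norm_add_le (G p - f p : Eu n) c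
    rw [norm_smul, hnorm, mul_one, Real.norm_eq_abs] at h2
    rw [h1]
    linarith [hGf p, hcp p]
  have hHnorm : ∀ p : Sph n, 1 / 2 < ‖H p‖ := by
    intro p
    have h1 := norm_sub_norm_le (f p : Eu n) (H p)
    rw [norm_sub_rev (f p : Eu n), hnorm] at h1
    linarith [hHf p]
  have hH0 : ∀ p : Sph n, H p ≠ 0 := fun p =>
    norm_pos_iff.1 ((by norm_num : (0 : ℝ) < 1 / 2).trans (hHnorm p))
  have hHsym : ∀ p : Sph n, H (-p) = Refl (p : Eu n) (H p) := by
    intro p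
    have hpp : ⟪(p : Eu n), (p : Eu n)⟫ = 1 := by
      rw [real_inner_self_eq_norm_sq, hnorm, one_pow]
    simp only [H, hGsym]
    simp only [Refl, inner_neg_right, inner_sub_right, inner_add_right, real_inner_smul_right, hpp,
      real_inner_comm c (p : Eu n)]
    module
  let K : Eu n → Eu n := fun x => ‖H x‖⁻¹ • H x
  have hHs : ∀ p : Sph n, ContDiffAt ℝ (⊤ : ℕ∞) H p := fun p =>
    ((hGs p (hne p)).add contDiffAt_const).sub
      ((contDiffAt_const.inner ℝ contDiffAt_id).smul contDiffAt_id)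
  have hKs : ∀ p : Sph n, ContDiffAt ℝ (⊤ : ℕ∞) K p := fun p =>
    (((hHs p).norm ℝ (hH0 p)).inv (norm_ne_zero_iff.2 (hH0 p))).smul (hHs p)
  have hKsphere : ∀ p : Sph n, K p ∈ sphere (0 : Eu n) 1 := by
    intro p
    simp [K, norm_smul, hH0 p]
  let g : Sph n → Sph n := Set.codRestrict (fun p : Sph n => K p) _ hKsphere
  have hgK : ∀ p, (g p : Eu n) = K p := fun _ => rfl
  have hg : ContMDiff (𝓡 n) (𝓡 n) (⊤ : ℕ∞) g := by
    refine ContMDiff.codRestrict_sphere (fun p => ?_) hKsphere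
    exact (hKs p).contMDiffAt.comp p (contMDiff_coe_sphere p)
  refine ⟨g, hg, ?_, ?_, ?_⟩
  · have hHc : Continuous fun p : Sph n => H p :=
      continuous_iff_continuousAt.2 fun p =>
        (hHs p).continuousAt.comp continuous_subtype_val.continuousAt
    exact homotopic_of_norm_sub_lt_one hHc (fun p => (hHf p).trans (by norm_num)) hgK
  · intro p
    have h1 : ((-p : Sph n) : Eu n) = -p := rfl
    simp only [hgK, K, h1, hHsym, norm_Refl (hnorm p), Refl_smul]
  · intro x hx
    have hKx : K x = x := by rw [← hgK, hx]
    refine bijective_mfderiv_sub_id_of_extension ((hg x).mdifferentiableAt (by simp))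
      ((hKs x).differentiableAt (by simp)) hgK hx fun v hxv hv => ?_
    exact eq_zero_of_fderiv_normalize_eq hGd hGhom hc rfl (hnorm x) (hH0 x)
      (by linarith [hHnorm x, neg_abs_le ⟪c, (x : Eu n)⟫, hcp x]) hKx hxv hv

end
end
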